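/- arXiv:2302.14324 — 4 statements merged into one kernel-verified Lean document; each statement's English description precedes it below -/
import Mathlib

section
/- Let p_Re ∈ ℝ[X] be a real polynomial of degree n. There exists a polynomial p ∈ ℂ[X] whose coefficient-wise real part is p_Re and a sequence Φ = (φ_0, …, φ_n) ∈ ℝ^{n+1} such that for all x ∈ [−1, 1] the (0,0) entry of QSP(Φ, x) equals p(x), if and only if: (a) p_Re is even or odd (a polynomial r is even if r(−x) = r(x) for all x and odd if r(−x) = −r(x) for all x), and (b) |p_Re(x)| ≤ 1 for all x ∈ [−1, 1]. -/
open Matrix Complex Polynomial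

/-- The reflection matrix `R(x)` appearing in quantum signal processing. -/
noncomputable def Rmat (x : ℝ) : Matrix (Fin 2) (Fin 2) ℂ :=
  !![(x : ℂ), (Real.sqrt (1 - x ^ 2) : ℂ); (Real.sqrt (1 - x ^ 2) : ℂ), -(x : ℂ)]

/-- The phase matrix `diag(e^{iφ}, e^{-iφ})`. -/
noncomputable def phaseMat (φ : ℝ) : Matrix (Fin 2) (Fin 2) ℂ :=
  !![Complex.exp (φ * Complex.I), 0; 0, Complex.exp (-(φ * Complex.I))]

/-- The quantum signal processing matrix. -/
noncomputable def QSP (n : ℕ) (Φ : ℕ → ℝ) (x : ℝ) : Matrix (Fin 2) (Fin 2) ℂ :=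
  phaseMat (Φ 0) * ((List.range n).map (fun j => Rmat x * phaseMat (Φ (j + 1)))).prod

/-- The polynomials of degree at most `n` all of whose exponents have the parity of `n`. -/
def parityDegreeLE (R : Type*) [CommRing R] (n : ℤ) : Submodule R R[X] where
  carrier := {p | ∀ k : ℕ, p.coeff k ≠ 0 → ∃ j : ℕ, (k : ℤ) + 2 * j = n}
  zero_mem' := by simp
  add_mem' := by
    intro p q hp hq k hk
    by_cases h : p.coeff k = 0
    · exact hq k (by simpa [h] using hk)
    · exact hp k h
  smul_mem' := by
    intro c p hp k hk
    refine hp k fun h => hk ?_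
    simp [h]

section ParityDegree

variable {R : Type*} [CommRing R]

theorem mul_mem_parityDegreeLE {a b c : ℤ} {p q : R[X]} (hp : p ∈ parityDegreeLE R a)
    (hq : q ∈ parityDegreeLE R b) (h : a + b = c) : p * q ∈ parityDegreeLE R c := by
  intro k hk
  rw [coeff_mul] at hk
  obtain ⟨⟨i, j⟩, hij, hne⟩ := Finset.exists_ne_zero_of_sum_ne_zero hk
  obtain ⟨u, hu⟩ := hp i (left_ne_zero_of_mul hne)
  obtain ⟨v, hv⟩ := hq j (right_ne_zero_of_mul hne)
  rw [Finset.HasAntidiagonal.mem_antidiagonal] at hij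
  exact ⟨u + v, by push_cast; simp only at hij; omega⟩

theorem parityDegreeLE_mono {a b : ℤ} (j : ℕ) (h : a + 2 * j = b) :
    parityDegreeLE R a ≤ parityDegreeLE R b := by
  intro p hp k hk
  obtain ⟨i, hi⟩ := hp k hk
  exact ⟨i + j, by push_cast; omega⟩

theorem C_mem_parityDegreeLE (a : R) : C a ∈ parityDegreeLE R 0 := by
  intro k hk
  rw [coeff_C] at hk
  refine ⟨0, ?_⟩
  by_contra h
  exact hk (if_neg (by omega))

theorem X_mem_parityDegreeLE : (X : R[X]) ∈ parityDegreeLE R 1 := by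
  intro k hk
  rw [coeff_X] at hk
  refine ⟨0, ?_⟩
  by_contra h
  exact hk (if_neg (by omega))

theorem X_sq_mem_parityDegreeLE : (X ^ 2 : R[X]) ∈ parityDegreeLE R 2 := by
  rw [sq]
  exact mul_mem_parityDegreeLE X_mem_parityDegreeLE X_mem_parityDegreeLE (by norm_num)

theorem one_sub_X_sq_mem_parityDegreeLE : (1 - X ^ 2 : R[X]) ∈ parityDegreeLE R 2 :=
  sub_mem (parityDegreeLE_mono 1 (by norm_num) (C_mem_parityDegreeLE 1)) X_sq_mem_parityDegreeLE

theorem C_mul_mem_parityDegreeLE {n : ℤ} {p : R[X]} (a : R) (hp : p ∈ parityDegreeLE R n) :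
    C a * p ∈ parityDegreeLE R n :=
  mul_mem_parityDegreeLE (C_mem_parityDegreeLE a) hp (zero_add n)

theorem map_mem_parityDegreeLE {S : Type*} [CommRing S] (f : R →+* S) {n : ℤ} {p : R[X]}
    (hp : p ∈ parityDegreeLE R n) : p.map f ∈ parityDegreeLE S n := by
  intro k hk
  refine hp k fun h => hk ?_
  rw [coeff_map, h, map_zero]

theorem mem_parityDegreeLE_of_coeff_eq_zero {n : ℤ} {p : R[X]} (d : ℕ) (hd : (d : ℤ) = n + 2)
    (hp : p ∈ parityDegreeLE R (n + 2)) (h : p.coeff d = 0) : p ∈ parityDegreeLE R n := by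
  intro k hk
  obtain ⟨j, hj⟩ := hp k hk
  rcases j with _ | j
  · have : k = d := by push_cast at hj; omega
    exact absurd h (this ▸ hk)
  · exact ⟨j, by push_cast at hj; omega⟩

theorem eval_neg_of_mem_parityDegreeLE {n : ℕ} {p : R[X]} (hp : p ∈ parityDegreeLE R n) (x : R) :
    p.eval (-x) = (-1) ^ n * p.eval x := by
  rw [eval_eq_sum_range, eval_eq_sum_range, Finset.mul_sum]
  refine Finset.sum_congr rfl fun k _ => ?_
  by_cases h : p.coeff k = 0
  · simp [h]
  · obtain ⟨j, hj⟩ := hp k h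
    have hn : n = k + 2 * j := by omega
    rw [neg_pow x k, hn, pow_add, pow_mul]
    simp only [even_two, Even.neg_pow, one_pow]
    ring

end ParityDegree

theorem mem_parityDegreeLE_of_even_or_odd {n : ℕ} {p : ℝ[X]} (hp : p.degree = n)
    (h : (∀ x : ℝ, p.eval (-x) = p.eval x) ∨ (∀ x : ℝ, p.eval (-x) = -p.eval x)) :
    p ∈ parityDegreeLE ℝ n := by
  have hsign : ∃ ε : ℝ, ∀ k, (-1) ^ k * p.coeff k = ε * p.coeff k := by
    rcases h with h | h
    · refine ⟨1, fun k => ?_⟩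
      have : p.comp (C (-1) * X) = p := Polynomial.funext fun x => by simpa using h x
      rw [mul_comm, ← comp_C_mul_X_coeff, this, one_mul]
    · refine ⟨-1, fun k => ?_⟩
      have : p.comp (C (-1) * X) = -p := Polynomial.funext fun x => by simpa using h x
      rw [mul_comm, ← comp_C_mul_X_coeff, this, coeff_neg, neg_one_mul]
  obtain ⟨ε, hε⟩ := hsign
  have hn : p.coeff n ≠ 0 := coeff_ne_zero_of_eq_degree hp
  intro k hk
  have hkn : k ≤ n := by
    have := le_degree_of_ne_zero hk
    rw [hp] at this
    exact_mod_cast this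
  have hpow : (-1 : ℝ) ^ k = (-1) ^ n :=
    (mul_right_cancel₀ hk (hε k)).trans (mul_right_cancel₀ hn (hε n)).symm
  have hev : Even k ↔ Even n := by
    rw [← neg_one_pow_eq_one_iff_even (R := ℝ) (by norm_num), hpow,
      neg_one_pow_eq_one_iff_even (by norm_num)]
  have : Even (n - k) := by
    rw [Nat.even_sub hkn]
    exact hev.symm
  obtain ⟨j, hj⟩ := this
  exact ⟨j, by omega⟩

/-- `f` is of the form `B ^ 2 + (1 - X ^ 2) * D ^ 2` where `B` and `D` have degree at most
`n` and `n - 1` and the parity of `n` and `n - 1`, respectively. -/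
def IsWeightedSumSq (n : ℕ) (f : ℝ[X]) : Prop :=
  ∃ B ∈ parityDegreeLE ℝ n, ∃ D ∈ parityDegreeLE ℝ (n - 1), f = B ^ 2 + (1 - X ^ 2) * D ^ 2

theorem IsWeightedSumSq.mul {m n : ℕ} {f g : ℝ[X]} (hf : IsWeightedSumSq m f)
    (hg : IsWeightedSumSq n g) : IsWeightedSumSq (m + n) (f * g) := by
  obtain ⟨B, hB, D, hD, rfl⟩ := hf
  obtain ⟨B', hB', D', hD', rfl⟩ := hg
  refine ⟨B * B' - (1 - X ^ 2) * (D * D'), ?_, B * D' + D * B', ?_, by ring⟩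
  · refine sub_mem (mul_mem_parityDegreeLE hB hB' (by push_cast; ring)) ?_
    exact mul_mem_parityDegreeLE one_sub_X_sq_mem_parityDegreeLE
      (mul_mem_parityDegreeLE hD hD' rfl) (by push_cast; ring)
  · exact add_mem (mul_mem_parityDegreeLE hB hD' (by push_cast; ring))
      (mul_mem_parityDegreeLE hD hB' (by push_cast; ring))

theorem isWeightedSumSq_C {a : ℝ} (ha : 0 ≤ a) : IsWeightedSumSq 0 (C a) :=
  ⟨C √a, C_mem_parityDegreeLE _, 0, zero_mem _, by rw [← C_pow, Real.sq_sqrt ha]; simp⟩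

theorem isWeightedSumSq_one_linear {a b : ℝ} (ha : 0 ≤ a) (hab : 0 ≤ a + b) :
    IsWeightedSumSq 1 (C a + C b * X ^ 2) := by
  refine ⟨C √(a + b) * X, C_mul_mem_parityDegreeLE _ (by simpa using X_mem_parityDegreeLE),
    C √a, by simpa using C_mem_parityDegreeLE _, ?_⟩
  rw [mul_pow, ← C_pow, ← C_pow, Real.sq_sqrt ha, Real.sq_sqrt hab, C_add]
  ring

theorem isWeightedSumSq_two_sq (a : ℝ) : IsWeightedSumSq 2 ((X ^ 2 - C a) ^ 2) := by
  refine ⟨X ^ 2 - C a, sub_mem X_sq_mem_parityDegreeLE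
    (parityDegreeLE_mono 1 (by norm_num) (C_mem_parityDegreeLE a)), 0, zero_mem _, by ring⟩

theorem isWeightedSumSq_two_normSq (z : ℂ) :
    IsWeightedSumSq 2 (X ^ 4 - C (2 * z.re) * X ^ 2 + C (‖z‖ ^ 2)) := by
  set r := ‖z‖
  set s := ‖1 - z‖
  have hs : s ^ 2 = 1 - 2 * z.re + r ^ 2 := by
    simp only [s, r, ← Complex.normSq_eq_norm_sq, Complex.normSq_apply]
    simp
    ring
  have hrs : 1 ≤ r + s := by
    simpa [r, s] using norm_add_le z (1 - z)
  have hc : 0 ≤ (r + s) ^ 2 - 1 := by nlinarith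
  refine ⟨C r - C (r + s) * X ^ 2, sub_mem (parityDegreeLE_mono 1 (by norm_num)
    (C_mem_parityDegreeLE _)) (C_mul_mem_parityDegreeLE _ X_sq_mem_parityDegreeLE),
    C √((r + s) ^ 2 - 1) * X, C_mul_mem_parityDegreeLE _ (by simpa using X_mem_parityDegreeLE), ?_⟩
  have hre : 2 * z.re = 1 + r ^ 2 - s ^ 2 := by linarith
  rw [mul_pow, ← C_pow, Real.sq_sqrt hc, hre]
  simp only [C_add, C_sub, C_pow, C_1]
  ring

theorem nonneg_of_mul_nonneg_on_Icc {q h : ℝ[X]} (hq0 : q ≠ 0)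
    (hq : ∀ t ∈ Set.Icc (0 : ℝ) 1, 0 ≤ q.eval t)
    (hqh : ∀ t ∈ Set.Icc (0 : ℝ) 1, 0 ≤ (q * h).eval t) :
    ∀ t ∈ Set.Icc (0 : ℝ) 1, 0 ≤ h.eval t := by
  have hdense : Set.Icc (0 : ℝ) 1 ⊆ closure (Set.Ioo 0 1 ∩ {t | q.eval t ≠ 0}) := by
    have hd : Dense {t : ℝ | q.eval t ≠ 0} := by
      have hfin : {t : ℝ | q.eval t = 0}.Finite := by
        refine (q.roots.toFinset.finite_toSet).subset fun t ht => ?_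
        simpa [hq0] using ht
      exact hfin.countable.dense_compl ℝ
    rw [Set.inter_comm, ← closure_Ioo zero_ne_one]
    exact closure_minimal (Set.inter_comm _ _ ▸ hd.open_subset_closure_inter isOpen_Ioo)
      isClosed_closure
  intro t ht
  refine closure_minimal (t := {t | 0 ≤ h.eval t}) ?_
    (isClosed_le continuous_const h.continuous) (hdense ht)
  rintro u ⟨hu, hqu⟩
  have hu' := Set.Ioo_subset_Icc_self hu
  have h1 := hqh u hu'
  rw [eval_mul] at h1
  exact nonneg_of_mul_nonneg_right h1 (lt_of_le_of_ne (hq u hu') (Ne.symm hqu))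

theorem exists_factor_of_nonneg_on_Icc {g : ℝ[X]} (hdeg : 0 < g.natDegree)
    (hg : ∀ t ∈ Set.Icc (0 : ℝ) 1, 0 ≤ g.eval t) :
    ∃ q : ℝ[X], q ∣ g ∧ 0 < q.natDegree ∧ (∀ t ∈ Set.Icc (0 : ℝ) 1, 0 ≤ q.eval t) ∧
      IsWeightedSumSq q.natDegree (expand ℝ 2 q) := by
  have hdeg' : (g.map (algebraMap ℝ ℂ)).degree ≠ 0 := by
    rw [degree_map]
    exact (natDegree_pos_iff_degree_pos.1 hdeg).ne'
  obtain ⟨z, hz⟩ := IsAlgClosed.exists_root _ hdeg'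
  rw [IsRoot, eval_map_algebraMap] at hz
  by_cases him : z.im = 0
  · obtain ⟨a, rfl⟩ : ∃ a : ℝ, z = a := ⟨z.re, Complex.ext rfl (by simp [him])⟩
    have ha : g.IsRoot a := by
      have h : ((g.eval a : ℝ) : ℂ) = 0 := by
        rw [← hz]
        exact (aeval_algebraMap_apply_eq_algebraMap_eval a g).symm
      exact_mod_cast h
    rcases le_or_gt a 0 with ha0 | ha0
    · refine ⟨X - C a, dvd_iff_isRoot.2 ha, by simp, fun t ht => ?_, ?_⟩
      · simp only [eval_sub, eval_X, eval_C]
        linarith [ht.1]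
      · have := isWeightedSumSq_one_linear (a := -a) (b := 1) (by linarith) (by linarith)
        convert this using 1
        · simp
        · simp; ring
    rcases le_or_gt 1 a with ha1 | ha1
    · have hn : (C a - X).natDegree = 1 := by
        rw [← neg_sub, natDegree_neg, natDegree_X_sub_C]
      refine ⟨C a - X, ?_, by omega, fun t ht => ?_, ?_⟩
      · rw [← neg_sub, neg_dvd]
        exact dvd_iff_isRoot.2 ha
      · simp only [eval_sub, eval_X, eval_C]
        linarith [ht.2]
      · have := isWeightedSumSq_one_linear (a := a) (b := -1) (by linarith) (by linarith)
        convert this using 1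
        simp; ring
    · refine ⟨(X - C a) ^ 2, ?_, by simp, fun t _ => ?_, ?_⟩
      · obtain ⟨h, rfl⟩ := dvd_iff_isRoot.2 ha
        rw [sq]
        refine mul_dvd_mul_left _ (dvd_iff_isRoot.2 ?_)
        have hleft : Set.Icc a 1 ⊆ {t | 0 ≤ h.eval t} := by
          rw [← closure_Ioc ha1.ne]
          refine closure_minimal (fun t ht => ?_) (isClosed_le continuous_const h.continuous)
          have := hg t ⟨by linarith [ht.1], ht.2⟩
          rw [eval_mul, eval_sub, eval_X, eval_C] at this
          exact nonneg_of_mul_nonneg_right this (sub_pos.2 ht.1)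
        have hright : Set.Icc 0 a ⊆ {t | h.eval t ≤ 0} := by
          rw [← closure_Ico ha0.ne]
          refine closure_minimal (fun t ht => ?_) (isClosed_le h.continuous continuous_const)
          have := hg t ⟨ht.1, by linarith [ht.2]⟩
          rw [eval_mul, eval_sub, eval_X, eval_C] at this
          have h2 := sub_neg.2 ht.2
          simp only [Set.mem_ofPred_eq]
          by_contra! h3
          nlinarith
        exact le_antisymm (hright ⟨ha0.le, le_rfl⟩) (hleft ⟨le_rfl, ha1.le⟩)
      · rw [eval_pow]
        positivity
      · rw [natDegree_pow, natDegree_X_sub_C]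
        simpa using isWeightedSumSq_two_sq a
  · have hn : (X ^ 2 - C (2 * z.re) * X + C (‖z‖ ^ 2)).natDegree = 2 := by
      compute_degree!
    refine ⟨X ^ 2 - C (2 * z.re) * X + C (‖z‖ ^ 2),
      quadratic_dvd_of_aeval_eq_zero_im_ne_zero g hz him, by omega, fun t _ => ?_, ?_⟩
    · simp only [eval_add, eval_sub, eval_mul, eval_pow, eval_X, eval_C]
      rw [← Complex.normSq_eq_norm_sq, Complex.normSq_apply]
      nlinarith [sq_nonneg (t - z.re), sq_nonneg z.im]
    · rw [hn]
      convert isWeightedSumSq_two_normSq z using 1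
      simp only [map_add, map_sub, map_mul, map_pow, expand_X, expand_C]
      ring

theorem isWeightedSumSq_expand (n : ℕ) : ∀ g : ℝ[X], g.natDegree ≤ n →
    (∀ t ∈ Set.Icc (0 : ℝ) 1, 0 ≤ g.eval t) → IsWeightedSumSq n (expand ℝ 2 g) := by
  induction n using Nat.strong_induction_on with
  | _ n ih =>
    intro g hdeg hg
    rcases Nat.eq_zero_or_pos g.natDegree with h0 | h0
    · rcases n with _ | n
      · rw [eq_C_of_natDegree_eq_zero h0, expand_C]
        refine isWeightedSumSq_C ?_
        rw [coeff_zero_eq_eval_zero]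
        exact hg 0 (by simp)
      · have h1 : IsWeightedSumSq 1 (1 : ℝ[X]) := by
          simpa using isWeightedSumSq_one_linear (a := 1) (b := 0) (by norm_num) (by norm_num)
        simpa using (ih n n.lt_succ_self g (by omega) hg).mul h1
    · obtain ⟨q, ⟨h, rfl⟩, hq, hq0, hqw⟩ := exists_factor_of_nonneg_on_Icc h0 hg
      have hne : q * h ≠ 0 := by
        rintro h'
        simp [h'] at h0
      have hsum := natDegree_mul (left_ne_zero_of_mul hne) (right_ne_zero_of_mul hne)
      have hw := ih (n - q.natDegree) (by omega) h (by omega)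
        (nonneg_of_mul_nonneg_on_Icc (left_ne_zero_of_mul hne) hq0 hg)
      have := hqw.mul hw
      rwa [← map_mul, Nat.add_sub_cancel' (by omega)] at this

theorem isWeightedSumSq_of_nonneg_on_Icc {n : ℕ} {f : ℝ[X]}
    (hf : f ∈ parityDegreeLE ℝ (2 * n)) (h : ∀ x ∈ Set.Icc (-1 : ℝ) 1, 0 ≤ f.eval x) :
    IsWeightedSumSq n f := by
  have hfg : expand ℝ 2 (contract 2 f) = f := by
    ext k
    rw [coeff_expand two_pos, coeff_contract two_ne_zero]
    split_ifs with hk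
    · rw [Nat.div_mul_cancel hk]
    · by_contra hne
      obtain ⟨j, hj⟩ := hf k (Ne.symm hne)
      omega
  rw [← hfg]
  refine isWeightedSumSq_expand n _ ?_ fun t ht => ?_
  · rw [natDegree_le_iff_coeff_eq_zero]
    intro k hk
    rw [coeff_contract two_ne_zero]
    by_contra hne
    obtain ⟨j, hj⟩ := hf _ hne
    push_cast at hj
    omega
  · rw [← Real.sq_sqrt ht.1, ← expand_eval, hfg]
    exact h _ ⟨by linarith [Real.sqrt_nonneg t], Real.sqrt_le_one.2 ht.2⟩

/-- The degree, parity and normalization conditions satisfied by the polynomials `P` and `Q` for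
which `(P, √(1 - x ^ 2) * Q)` is the first row of a QSP matrix with `n + 1` phase factors. -/
structure IsQSPPair (n : ℕ) (P Q : ℂ[X]) : Prop where
  fst_mem : P ∈ parityDegreeLE ℂ n
  snd_mem : Q ∈ parityDegreeLE ℂ (n - 1)
  normalized : P * P.map (starRingEnd ℂ) + (1 - X ^ 2) * (Q * Q.map (starRingEnd ℂ)) = 1

/-- The first row of `QSP n Φ x` is `(P x, √(1 - x ^ 2) * Q x)` for all `x ∈ [-1, 1]`. -/
def IsQSPRow (n : ℕ) (Φ : ℕ → ℝ) (P Q : ℂ[X]) : Prop :=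
  ∀ x ∈ Set.Icc (-1 : ℝ) 1, QSP n Φ x 0 0 = P.eval (x : ℂ) ∧
    QSP n Φ x 0 1 = (√(1 - x ^ 2) : ℝ) * Q.eval (x : ℂ)

theorem QSP_zero (Φ : ℕ → ℝ) (x : ℝ) : QSP 0 Φ x = phaseMat (Φ 0) := by
  simp [QSP]

theorem QSP_succ (n : ℕ) (Φ : ℕ → ℝ) (x : ℝ) :
    QSP (n + 1) Φ x = QSP n Φ x * (Rmat x * phaseMat (Φ (n + 1))) := by
  simp [QSP, List.range_succ, Matrix.mul_assoc]

theorem QSP_congr {n : ℕ} {Φ Ψ : ℕ → ℝ} (h : ∀ j ≤ n, Φ j = Ψ j) (x : ℝ) :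
    QSP n Φ x = QSP n Ψ x := by
  induction n with
  | zero => rw [QSP_zero, QSP_zero, h 0 le_rfl]
  | succ n ih => rw [QSP_succ, QSP_succ, ih fun j hj => h j (by omega), h (n + 1) le_rfl]

theorem isQSPRow_zero (Φ : ℕ → ℝ) : IsQSPRow 0 Φ (C (Complex.exp (Φ 0 * Complex.I))) 0 := by
  intro x _
  simp [QSP_zero, phaseMat]

theorem IsQSPRow.succ {n : ℕ} {Φ : ℕ → ℝ} {P Q : ℂ[X]} (h : IsQSPRow n Φ P Q) :
    IsQSPRow (n + 1) Φ
      (C (Complex.exp (Φ (n + 1) * Complex.I)) * (X * P + (1 - X ^ 2) * Q))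
      (C (Complex.exp (-(Φ (n + 1) * Complex.I))) * (P - X * Q)) := by
  intro x hx
  obtain ⟨h0, h1⟩ := h x hx
  have hs : ((√(1 - x ^ 2) : ℝ) : ℂ) * (√(1 - x ^ 2) : ℝ) = 1 - (x : ℂ) ^ 2 := by
    have : 0 ≤ 1 - x ^ 2 := by nlinarith [hx.1, hx.2]
    rw [← Complex.ofReal_mul, Real.mul_self_sqrt this]
    push_cast
    rfl
  rw [QSP_succ]
  simp only [Matrix.mul_apply, Fin.sum_univ_two, h0, h1, Rmat, phaseMat, Matrix.of_apply,
    Matrix.cons_val', Matrix.cons_val_zero, Matrix.cons_val_one, Matrix.cons_val_fin_one,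
    eval_mul, eval_add, eval_sub, eval_C, eval_X, eval_pow, eval_one]
  refine ⟨?_, by ring⟩
  linear_combination Complex.exp (Φ (n + 1) * Complex.I) * Q.eval (x : ℂ) * hs

theorem conj_exp_mul_I (φ : ℝ) :
    (starRingEnd ℂ) (Complex.exp (φ * Complex.I)) = Complex.exp (-(φ * Complex.I)) := by
  rw [← Complex.exp_conj]
  simp

theorem isQSPPair_zero (φ : ℝ) : IsQSPPair 0 (C (Complex.exp (φ * Complex.I))) 0 where
  fst_mem := C_mem_parityDegreeLE _
  snd_mem := zero_mem _
  normalized := by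
    rw [map_C, conj_exp_mul_I, ← C_mul, ← Complex.exp_add]
    simp

theorem IsQSPPair.succ {n : ℕ} {P Q : ℂ[X]} (h : IsQSPPair n P Q) {u v : ℂ}
    (huv : u * v = 1) (hu : (starRingEnd ℂ) u = v) :
    IsQSPPair (n + 1) (C u * (X * P + (1 - X ^ 2) * Q)) (C v * (P - X * Q)) where
  fst_mem := by
    refine C_mul_mem_parityDegreeLE _ (add_mem ?_ ?_)
    · exact mul_mem_parityDegreeLE X_mem_parityDegreeLE h.fst_mem (by push_cast; ring)
    · exact mul_mem_parityDegreeLE one_sub_X_sq_mem_parityDegreeLE h.snd_mem (by push_cast; ring)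
  snd_mem := by
    refine C_mul_mem_parityDegreeLE _ (sub_mem ?_ ?_)
    · simpa using h.fst_mem
    · exact mul_mem_parityDegreeLE X_mem_parityDegreeLE h.snd_mem (by push_cast; ring)
  normalized := by
    have hv : (starRingEnd ℂ) v = u := by rw [← hu, Complex.conj_conj]
    have huv' : C u * C v = 1 := by rw [← C_mul, huv, C_1]
    simp only [Polynomial.map_mul, Polynomial.map_add, Polynomial.map_sub, Polynomial.map_pow,
      Polynomial.map_one, map_X, map_C, hu, hv]
    set P' := P.map (starRingEnd ℂ)
    set Q' := Q.map (starRingEnd ℂ)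
    linear_combination (P * P' + (1 - X ^ 2) * (Q * Q')) * huv' + h.normalized

theorem IsQSPPair.norm_top_coeff_eq {n : ℕ} {P Q : ℂ[X]} (h : IsQSPPair (n + 1) P Q) :
    ‖P.coeff (n + 1)‖ = ‖Q.coeff n‖ := by
  have hP : P.natDegree ≤ n + 1 := by
    refine natDegree_le_iff_coeff_eq_zero.2 fun k hk => ?_
    by_contra hne
    obtain ⟨j, hj⟩ := h.fst_mem k hne
    push_cast at hj
    omega
  have hQ : Q.natDegree ≤ n := by
    refine natDegree_le_iff_coeff_eq_zero.2 fun k hk => ?_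
    by_contra hne
    obtain ⟨j, hj⟩ := h.snd_mem k hne
    push_cast at hj
    omega
  have hP' := (natDegree_map_le (f := starRingEnd ℂ) (p := P)).trans hP
  have hQ' := (natDegree_map_le (f := starRingEnd ℂ) (p := Q)).trans hQ
  have hQQ : (Q * Q.map (starRingEnd ℂ)).natDegree ≤ n + n := natDegree_mul_le_of_le hQ hQ'
  have hw : (1 - X ^ 2 : ℂ[X]).natDegree ≤ 2 := by compute_degree
  have hw2 : (1 - X ^ 2 : ℂ[X]).coeff 2 = -1 := by simp [coeff_one]
  have key := congr_arg (fun p => p.coeff ((n + 1) + (n + 1))) h.normalized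
  simp only [coeff_add] at key
  rw [coeff_mul_add_eq_of_natDegree_le hP hP', show n + 1 + (n + 1) = 2 + (n + n) by ring,
    coeff_mul_add_eq_of_natDegree_le hw hQQ, coeff_mul_add_eq_of_natDegree_le hQ hQ', hw2,
    coeff_map, coeff_map, Complex.mul_conj', Complex.mul_conj', coeff_one, if_neg (by omega)] at key
  have key' : ‖P.coeff (n + 1)‖ ^ 2 = ‖Q.coeff n‖ ^ 2 := by
    have : ((‖P.coeff (n + 1)‖ ^ 2 : ℝ) : ℂ) = ((‖Q.coeff n‖ ^ 2 : ℝ) : ℂ) := by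
      push_cast
      linear_combination key
    exact_mod_cast this
  exact (sq_eq_sq₀ (norm_nonneg _) (norm_nonneg _)).1 key'

theorem exists_phase_of_norm_eq {a b : ℂ} (h : ‖a‖ = ‖b‖) :
    ∃ φ : ℝ, Complex.exp (-(φ * Complex.I)) * a = Complex.exp (φ * Complex.I) * b := by
  refine ⟨(a.arg - b.arg) / 2, ?_⟩
  have ha := Complex.norm_mul_exp_arg_mul_I a
  have hb := Complex.norm_mul_exp_arg_mul_I b
  rw [h] at ha
  generalize a.arg = α at ha ⊢
  generalize b.arg = β at hb ⊢
  rw [← hb, ← ha, mul_left_comm, ← Complex.exp_add, mul_left_comm, ← Complex.exp_add]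
  congr 2
  push_cast
  ring

theorem IsQSPPair.exists_pred {n : ℕ} {P Q : ℂ[X]} (h : IsQSPPair (n + 1) P Q) :
    ∃ (φ : ℝ) (P' Q' : ℂ[X]), IsQSPPair n P' Q' ∧
      P = C (Complex.exp (φ * Complex.I)) * (X * P' + (1 - X ^ 2) * Q') ∧
      Q = C (Complex.exp (-(φ * Complex.I))) * (P' - X * Q') := by
  obtain ⟨φ, hφ⟩ := exists_phase_of_norm_eq h.norm_top_coeff_eq
  have hu := conj_exp_mul_I φ
  have huv : Complex.exp (φ * Complex.I) * Complex.exp (-(φ * Complex.I)) = 1 := by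
    rw [← Complex.exp_add, add_neg_cancel, Complex.exp_zero]
  refine ⟨φ, ?_⟩
  generalize Complex.exp (φ * Complex.I) = u at hφ hu huv ⊢
  generalize Complex.exp (-(φ * Complex.I)) = v at hφ hu huv ⊢
  have hv : (starRingEnd ℂ) v = u := by rw [← hu, Complex.conj_conj]
  have huv' : C u * C v = 1 := by rw [← C_mul, huv, C_1]
  have hQ : Q.coeff (n + 2) = 0 := by
    by_contra hne
    obtain ⟨j, hj⟩ := h.snd_mem _ hne
    push_cast at hj
    omega
  refine ⟨C v * (X * P) + C u * ((1 - X ^ 2) * Q), C v * P - C u * (X * Q), ⟨?_, ?_, ?_⟩, ?_, ?_⟩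
  · refine mem_parityDegreeLE_of_coeff_eq_zero (n + 2) (by push_cast; ring) (add_mem ?_ ?_) ?_
    · exact C_mul_mem_parityDegreeLE _
        (mul_mem_parityDegreeLE X_mem_parityDegreeLE h.fst_mem (by push_cast; ring))
    · exact C_mul_mem_parityDegreeLE _
        (mul_mem_parityDegreeLE one_sub_X_sq_mem_parityDegreeLE h.snd_mem (by push_cast; ring))
    · rw [sub_mul, one_mul, coeff_add, coeff_C_mul, coeff_C_mul, coeff_X_mul, coeff_sub,
        coeff_X_pow_mul, hQ]
      linear_combination hφ
  · refine mem_parityDegreeLE_of_coeff_eq_zero (n + 1) (by push_cast; ring) (sub_mem ?_ ?_) ?_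
    · exact C_mul_mem_parityDegreeLE _ (by convert h.fst_mem using 1; push_cast; ring_nf)
    · exact C_mul_mem_parityDegreeLE _
        (mul_mem_parityDegreeLE X_mem_parityDegreeLE h.snd_mem (by push_cast; ring))
    · rw [coeff_sub, coeff_C_mul, coeff_C_mul, coeff_X_mul]
      linear_combination hφ
  · simp only [Polynomial.map_mul, Polynomial.map_add, Polynomial.map_sub, Polynomial.map_pow,
      Polynomial.map_one, map_X, map_C, hu, hv]
    set P' := P.map (starRingEnd ℂ)
    set Q' := Q.map (starRingEnd ℂ)
    linear_combination (P * P' + (1 - X ^ 2) * (Q * Q')) * huv' + h.normalized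
  · linear_combination -P * huv'
  · linear_combination -Q * huv'

theorem isQSPRow_of_phases (n : ℕ) (Φ : ℕ → ℝ) : ∃ P Q, IsQSPPair n P Q ∧ IsQSPRow n Φ P Q := by
  induction n with
  | zero => exact ⟨_, _, isQSPPair_zero (Φ 0), isQSPRow_zero Φ⟩
  | succ n ih =>
    obtain ⟨P, Q, h, hrow⟩ := ih
    refine ⟨_, _, h.succ ?_ (conj_exp_mul_I (Φ (n + 1))), hrow.succ⟩
    rw [← Complex.exp_add, add_neg_cancel, Complex.exp_zero]

theorem IsQSPPair.exists_phases {n : ℕ} : ∀ {P Q : ℂ[X]}, IsQSPPair n P Q →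
    ∃ Φ, IsQSPRow n Φ P Q := by
  induction n with
  | zero =>
    intro P Q h
    have hQ : Q = 0 := by
      ext k
      by_contra hne
      obtain ⟨j, hj⟩ := h.snd_mem k hne
      push_cast at hj
      omega
    obtain ⟨a, rfl⟩ : ∃ a, P = C a := by
      refine ⟨P.coeff 0, eq_C_of_natDegree_eq_zero (Nat.le_zero.1 ?_)⟩
      refine natDegree_le_iff_coeff_eq_zero.2 fun k hk => ?_
      by_contra hne
      obtain ⟨j, hj⟩ := h.fst_mem k hne
      push_cast at hj
      omega
    have ha : ‖a‖ = 1 := by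
      have := h.normalized
      rw [hQ, map_C, ← C_mul, zero_mul, mul_zero, add_zero, ← C_1, C_inj, Complex.mul_conj'] at this
      exact (pow_eq_one_iff_of_nonneg (norm_nonneg a) two_ne_zero).1 (by exact_mod_cast this)
    refine ⟨fun _ => a.arg, ?_⟩
    have := isQSPRow_zero fun _ => a.arg
    rwa [← one_mul (Complex.exp _), ← Complex.ofReal_one, ← ha, Complex.norm_mul_exp_arg_mul_I,
      ← hQ] at this
  | succ n ih =>
    intro P Q h
    obtain ⟨φ, P', Q', h', rfl, rfl⟩ := h.exists_pred
    obtain ⟨Φ, hΦ⟩ := ih h'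
    have hrow : IsQSPRow n (Function.update Φ (n + 1) φ) P' Q' := by
      intro x hx
      rw [QSP_congr (Ψ := Φ) fun j hj => Function.update_of_ne (by omega) _ _]
      exact hΦ x hx
    exact ⟨_, by simpa using hrow.succ⟩

theorem IsQSPPair.norm_eval_le_one {n : ℕ} {P Q : ℂ[X]} (h : IsQSPPair n P Q) {x : ℝ}
    (hx : x ∈ Set.Icc (-1 : ℝ) 1) : ‖P.eval (x : ℂ)‖ ≤ 1 := by
  have hconj (p : ℂ[X]) :
      (p.map (starRingEnd ℂ)).eval (x : ℂ) = (starRingEnd ℂ) (p.eval (x : ℂ)) := by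
    conv_lhs => rw [← Complex.conj_ofReal x]
    rw [eval_map_apply]
  have key := congr_arg (eval (x : ℂ)) h.normalized
  simp only [eval_add, eval_mul, eval_sub, eval_one, eval_pow, eval_X, hconj,
    Complex.mul_conj'] at key
  have key' : ‖P.eval (x : ℂ)‖ ^ 2 + (1 - x ^ 2) * ‖Q.eval (x : ℂ)‖ ^ 2 = 1 := by
    exact_mod_cast key
  have hw : 0 ≤ 1 - x ^ 2 := by nlinarith [hx.1, hx.2]
  have := mul_nonneg hw (sq_nonneg ‖Q.eval (x : ℂ)‖)
  exact (sq_le_one_iff₀ (norm_nonneg _)).1 (by linarith)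

theorem re_eval_ofReal {p : ℂ[X]} {r : ℝ[X]} (h : ∀ k, (p.coeff k).re = r.coeff k) (x : ℝ) :
    (p.eval (x : ℂ)).re = r.eval x := by
  have hle : r.natDegree ≤ p.natDegree := natDegree_le_iff_coeff_eq_zero.2 fun k hk => by
    rw [← h, coeff_eq_zero_of_natDegree_lt hk, Complex.zero_re]
  rw [eval_eq_sum_range, eval_eq_sum_range' (Nat.lt_succ_of_le hle), Complex.re_sum]
  refine Finset.sum_congr rfl fun k _ => ?_
  rw [← h, ← Complex.ofReal_pow, Complex.re_mul_ofReal]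

theorem isQSPPair_of_sumSq {n : ℕ} {A B D : ℝ[X]} (hA : A ∈ parityDegreeLE ℝ n)
    (hB : B ∈ parityDegreeLE ℝ n) (hD : D ∈ parityDegreeLE ℝ (n - 1))
    (h : 1 - A ^ 2 = B ^ 2 + (1 - X ^ 2) * D ^ 2) :
    IsQSPPair n (A.map Complex.ofRealHom + C Complex.I * B.map Complex.ofRealHom)
      (D.map Complex.ofRealHom) where
  fst_mem := add_mem (map_mem_parityDegreeLE _ hA)
    (C_mul_mem_parityDegreeLE _ (map_mem_parityDegreeLE _ hB))
  snd_mem := map_mem_parityDegreeLE _ hD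
  normalized := by
    have hreal : (starRingEnd ℂ).comp Complex.ofRealHom = Complex.ofRealHom :=
      RingHom.ext Complex.conj_ofReal
    have hI : (C Complex.I * C Complex.I : ℂ[X]) = -1 := by
      rw [← C_mul, Complex.I_mul_I, C_neg, C_1]
    have h' := congr_arg (map Complex.ofRealHom) h
    simp only [Polynomial.map_mul, Polynomial.map_add, Polynomial.map_sub, Polynomial.map_pow,
      Polynomial.map_one, map_X, map_C, Polynomial.map_map, hreal, Complex.conj_I, C_neg] at h' ⊢
    linear_combination -(map Complex.ofRealHom B) ^ 2 * hI - h'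

/-- **Achievability of bounded real polynomials** (Theorem 2.4): a real
polynomial `p_Re` of degree `n` is the real part of a QSP-achievable
polynomial iff it is even or odd and bounded by `1` in absolute value on
`[-1, 1]`. -/
theorem qsp_real_achievable (n : ℕ) (pRe : Polynomial ℝ) (hp : pRe.degree = n) :
    (∃ (p : Polynomial ℂ) (Φ : ℕ → ℝ),
      (∀ k, (p.coeff k).re = pRe.coeff k) ∧
      (∀ x : ℝ, x ∈ Set.Icc (-1 : ℝ) 1 → (QSP n Φ x) 0 0 = p.eval (x : ℂ))) ↔
    (((∀ x : ℝ, pRe.eval (-x) = pRe.eval x) ∨ (∀ x : ℝ, pRe.eval (-x) = -pRe.eval x)) ∧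
      (∀ x : ℝ, x ∈ Set.Icc (-1 : ℝ) 1 → |pRe.eval x| ≤ 1)) := by
  constructor
  · rintro ⟨p, Φ, hre, hp'⟩
    obtain ⟨P, Q, hPQ, hrow⟩ := isQSPRow_of_phases n Φ
    have hpP : p = P := by
      refine eq_of_infinite_eval_eq _ _ (Set.Infinite.mono (s := Set.image (fun x : ℝ => (x : ℂ))
        (Set.Icc (-1) 1)) ?_ ((Set.Icc_infinite (by norm_num)).image
        Complex.ofReal_injective.injOn))
      rintro _ ⟨x, hx, rfl⟩
      exact (hp' x hx).symm.trans (hrow x hx).1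
    subst hpP
    have hmem : pRe ∈ parityDegreeLE ℝ n := by
      intro k hk
      refine hPQ.fst_mem k fun h => hk ?_
      rw [← hre, h, Complex.zero_re]
    refine ⟨?_, fun x hx => ?_⟩
    · rcases Nat.even_or_odd n with hn | hn
      · exact Or.inl fun x => by rw [eval_neg_of_mem_parityDegreeLE hmem, hn.neg_one_pow, one_mul]
      · exact Or.inr fun x => by
          rw [eval_neg_of_mem_parityDegreeLE hmem, hn.neg_one_pow, neg_one_mul]
    · rw [← re_eval_ofReal hre]
      exact (Complex.abs_re_le_norm _).trans (hPQ.norm_eval_le_one hx)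
  · rintro ⟨hpar, hbd⟩
    have hA := mem_parityDegreeLE_of_even_or_odd hp hpar
    have hmem : 1 - pRe ^ 2 ∈ parityDegreeLE ℝ (2 * n) := by
      refine sub_mem (parityDegreeLE_mono n (by ring) (C_mem_parityDegreeLE 1)) ?_
      rw [sq]
      exact mul_mem_parityDegreeLE hA hA (by ring)
    obtain ⟨B, hB, D, hD, h⟩ := isWeightedSumSq_of_nonneg_on_Icc hmem fun x hx => by
      simpa using hbd x hx
    have hPQ := isQSPPair_of_sumSq hA hB hD h
    obtain ⟨Φ, hΦ⟩ := hPQ.exists_phases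
    exact ⟨_, Φ, fun k => by simp, fun x hx => (hΦ x hx).1⟩
end

section
/- For every integer n ≥ 1 and every real t ≠ 0, the modified Bessel function of the first kind satisfies |I_n(t)| < exp(√(t² + n²)) · (√((n/t)² + 1) − n/|t|)^n / (2·(n² + t²)^{1/4}). -/
open Real

/-- The modified Bessel function of the first kind (of integer order), via the
integral representation `I_n(t) = (1/π) ∫₀^π e^{t cos θ} cos(nθ) dθ`. -/
noncomputable def besselI (n : ℕ) (t : ℝ) : ℝ :=
  (1 / π) * ∫ θ in (0 : ℝ)..π, Real.exp (t * Real.cos θ) * Real.cos (n * θ)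

open intervalIntegral

section CosineIntegrals

variable {A B : ℝ}

lemma sub_mul_cos_pos (hB : |B| < A) (θ : ℝ) : 0 < A - B * cos θ := by
  have h : B * cos θ ≤ |B| := (le_abs_self _).trans <| by
    rw [abs_mul]; exact mul_le_of_le_one_right (abs_nonneg _) (abs_cos_le_one θ)
  linarith

lemma continuous_inv_sub_mul_cos (hB : |B| < A) : Continuous fun θ ↦ (A - B * cos θ)⁻¹ :=
  Continuous.inv₀ (by fun_prop) fun θ ↦ (sub_mul_cos_pos hB θ).ne'

lemma integral_inv_sub_mul_cos (hB : |B| < A) :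
    ∫ θ in (0 : ℝ)..π, (A - B * cos θ)⁻¹ = π / √(A ^ 2 - B ^ 2) := by
  have hq2 : 0 < A ^ 2 - B ^ 2 := by
    have := sq_lt_sq' (by linarith [abs_nonneg B]) hB
    rw [sq_abs] at this; linarith
  set q := √(A ^ 2 - B ^ 2) with hq
  have hq0 : 0 < q := Real.sqrt_pos.2 hq2
  have hqs : q ^ 2 = A ^ 2 - B ^ 2 := Real.sq_sqrt hq2.le
  have hderiv : ∀ θ : ℝ, HasDerivAt
      (fun θ ↦ (θ + 2 * arctan (B * sin θ / (A + q - B * cos θ))) / q) (A - B * cos θ)⁻¹ θ := by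
    intro θ
    have hD := sub_mul_cos_pos hB θ
    have hE : 0 < A + q - B * cos θ := by linarith
    have h := (((hasDerivAt_id θ).add (((((hasDerivAt_sin θ).const_mul B).div
      (((hasDerivAt_cos θ).const_mul B).const_sub (A + q)) hE.ne').arctan).const_mul 2)).div_const q)
    refine h.congr_deriv ?_
    have hs : sin θ ^ 2 = 1 - cos θ ^ 2 := by linarith [sin_sq_add_cos_sq θ]
    have hkey : (A + q - B * cos θ) ^ 2 + (B * sin θ) ^ 2 =
        2 * (A + q) * (A - B * cos θ) := by
      rw [mul_pow, hs]; linear_combination hqs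
    have hAq : 0 < A + q := by linarith [abs_nonneg B]
    have h1 : 1 + (B * sin θ / (A + q - B * cos θ)) ^ 2 =
        2 * (A + q) * (A - B * cos θ) / (A + q - B * cos θ) ^ 2 := by
      rw [← hkey]; field_simp
    simp only [Pi.div_apply]
    rw [h1]
    field_simp
    ring_nf
    rw [hs]
    linear_combination (-1 : ℝ) * hqs
  rw [integral_eq_sub_of_hasDerivAt (fun θ _ ↦ hderiv θ)
    ((continuous_inv_sub_mul_cos hB).intervalIntegrable _ _)]
  simp

lemma integral_inv_sub_mul_cos_pow_succ_succ (hB : |B| < A) (k : ℕ) :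
    (k + 1) * (A ^ 2 - B ^ 2) * ∫ θ in (0 : ℝ)..π, (A - B * cos θ)⁻¹ ^ (k + 2) =
      (2 * k + 1) * A * (∫ θ in (0 : ℝ)..π, (A - B * cos θ)⁻¹ ^ (k + 1)) -
        k * ∫ θ in (0 : ℝ)..π, (A - B * cos θ)⁻¹ ^ k := by
  have hc := continuous_inv_sub_mul_cos hB
  have hint (j : ℕ) (c : ℝ) :
      IntervalIntegrable (fun θ ↦ c * (A - B * cos θ)⁻¹ ^ j) MeasureTheory.volume 0 π :=
    ((hc.pow j).const_mul c).intervalIntegrable _ _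
  have hderiv : ∀ θ : ℝ, HasDerivAt (fun θ ↦ B * sin θ * (A - B * cos θ)⁻¹ ^ (k + 1))
      ((k + 1) * (A ^ 2 - B ^ 2) * (A - B * cos θ)⁻¹ ^ (k + 2) -
        (2 * k + 1) * A * (A - B * cos θ)⁻¹ ^ (k + 1) + k * (A - B * cos θ)⁻¹ ^ k) θ := by
    intro θ
    have hD := sub_mul_cos_pos hB θ
    have h := ((hasDerivAt_sin θ).const_mul B).mul
      (((((hasDerivAt_cos θ).const_mul B).const_sub A).inv hD.ne').pow (k + 1))
    refine h.congr_deriv ?_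
    have hs : sin θ ^ 2 = 1 - cos θ ^ 2 := by linarith [sin_sq_add_cos_sq θ]
    simp only [Nat.add_sub_cancel, Nat.cast_add, Nat.cast_one, inv_pow, Pi.inv_apply, Pi.pow_apply]
    field_simp
    ring_nf
    rw [hs]
    ring
  have h := integral_eq_sub_of_hasDerivAt (a := 0) (b := π) (fun θ _ ↦ hderiv θ)
    (((hint _ _).sub (hint _ _)).add (hint _ _))
  rw [integral_add ((hint _ _).sub (hint _ _)) (hint _ _), integral_sub (hint _ _) (hint _ _)] at h
  simp only [integral_const_mul, sin_pi, sin_zero] at h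
  linarith

end CosineIntegrals

lemma integral_inv_one_add_mul_one_sub_cos_pow_five {a : ℝ} (ha : 0 ≤ a) :
    ∫ θ in (0 : ℝ)..π, (1 + a / 2 * (1 - cos θ))⁻¹ ^ 5 =
      π * (1 + 2 * a + 9 / 4 * a ^ 2 + 5 / 4 * a ^ 3 + 35 / 128 * a ^ 4) /
        ((1 + a) ^ 4 * √(1 + a)) := by
  have hB : |a / 2| < 1 + a / 2 := by rw [abs_of_nonneg (by linarith)]; linarith
  have hAB : (1 + a / 2) ^ 2 - (a / 2) ^ 2 = 1 + a := by ring
  have h1 := integral_inv_sub_mul_cos hB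
  have hrec := integral_inv_sub_mul_cos_pow_succ_succ hB
  rw [hAB] at h1 hrec
  have h2 := hrec 0
  have h3 := hrec 1
  have h4 := hrec 2
  have h5 := hrec 3
  have he : ∀ θ, 1 + a / 2 * (1 - cos θ) = 1 + a / 2 - a / 2 * cos θ := fun θ ↦ by ring
  simp only [he, inv_pow]
  norm_num at h2 h3 h4 h5
  have h0 : 1 + a ≠ 0 := by linarith
  have hsq : √(1 + a) ≠ 0 := (Real.sqrt_pos.2 (by linarith)).ne'
  rw [h1] at h2 h3
  replace h2 := eq_div_of_mul_eq (by positivity) ((mul_comm _ _).trans h2)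
  replace h3 := eq_div_of_mul_eq (by positivity) ((mul_comm _ _).trans h3)
  replace h4 := eq_div_of_mul_eq (by positivity) ((mul_comm _ _).trans h4)
  replace h5 := eq_div_of_mul_eq (by positivity) ((mul_comm _ _).trans h5)
  rw [h5, h4, h3, h2]
  field_simp
  ring

lemma exp_neg_le_inv_one_add_div_pow {x : ℝ} (hx : 0 ≤ x) (m : ℕ) :
    exp (-x) ≤ (1 + x / m)⁻¹ ^ m := by
  rcases Nat.eq_zero_or_pos m with rfl | hm
  · simpa using hx
  have hm' : (0 : ℝ) < m := by exact_mod_cast hm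
  rw [inv_pow, exp_neg]
  refine inv_anti₀ (by positivity) ?_
  calc (1 + x / m) ^ m ≤ exp (x / m) ^ m := by
        gcongr
        linarith [add_one_le_exp (x / m)]
    _ = exp x := by rw [← exp_nat_mul]; congr 1; field_simp

lemma besselI_zero_lt {s : ℝ} (hs : 1 ≤ s) : besselI 0 s < exp s / (2 * √s) := by
  set a := 2 * s / 5 with ha
  have ha0 : 2 / 5 ≤ a := by rw [ha]; linarith
  have hB : |a / 2| < 1 + a / 2 := by rw [abs_of_nonneg (by linarith)]; linarith
  set P := 1 + 2 * a + 9 / 4 * a ^ 2 + 5 / 4 * a ^ 3 + 35 / 128 * a ^ 4 with hP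
  have hle : ∫ θ in (0 : ℝ)..π, exp (s * cos θ) ≤
      exp s * ∫ θ in (0 : ℝ)..π, (1 + a / 2 * (1 - cos θ))⁻¹ ^ 5 := by
    rw [← integral_const_mul]
    refine integral_mono_on pi_pos.le (Continuous.intervalIntegrable (by fun_prop) _ _)
      (Continuous.intervalIntegrable ?_ _ _) fun θ _ ↦ ?_
    · have := continuous_inv_sub_mul_cos hB
      have he : ∀ θ, 1 + a / 2 * (1 - cos θ) = 1 + a / 2 - a / 2 * cos θ := fun θ ↦ by ring
      simp only [he]
      fun_prop
    · have hx : 0 ≤ s * (1 - cos θ) := mul_nonneg (by linarith) (by linarith [cos_le_one θ])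
      have h := exp_neg_le_inv_one_add_div_pow hx 5
      have h1 : s * cos θ = s + -(s * (1 - cos θ)) := by ring
      have h2 : a / 2 * (1 - cos θ) = s * (1 - cos θ) / (5 : ℕ) := by rw [ha]; push_cast; ring
      rw [h1, exp_add, h2]
      gcongr
  rw [integral_inv_one_add_mul_one_sub_cos_pow_five (by linarith), ← hP] at hle
  have hP0 : 0 < P := by positivity
  have hpoly : 4 * s * P ^ 2 < (1 + a) ^ 9 := by
    obtain ⟨b, hb⟩ : ∃ b, b = a - 2 / 5 := ⟨_, rfl⟩
    have hb0 : 0 ≤ b := by linarith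
    have hab : a = b + 2 / 5 := by linarith
    have hsb : s = 5 / 2 * b + 1 := by linarith
    rw [← sub_pos, hP, hab, hsb]
    ring_nf
    positivity
  have hroot : 2 * √s * P < (1 + a) ^ 4 * √(1 + a) := by
    refine lt_of_pow_lt_pow_left₀ 2 (by positivity) ?_
    calc (2 * √s * P) ^ 2 = 4 * s * P ^ 2 := by
          rw [mul_pow, mul_pow, Real.sq_sqrt (by linarith)]; ring
      _ < (1 + a) ^ 9 := hpoly
      _ = ((1 + a) ^ 4 * √(1 + a)) ^ 2 := by
          rw [mul_pow, Real.sq_sqrt (by linarith)]; ring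
  have hI : besselI 0 s = 1 / π * ∫ θ in (0 : ℝ)..π, exp (s * cos θ) := by simp [besselI]
  have hs0 : 0 < √s := Real.sqrt_pos.2 (by linarith)
  have hq0 : 0 < √(1 + a) := Real.sqrt_pos.2 (by linarith)
  calc besselI 0 s ≤ 1 / π * (exp s * (π * P / ((1 + a) ^ 4 * √(1 + a)))) := by
        rw [hI]; gcongr
    _ = exp s * (P / ((1 + a) ^ 4 * √(1 + a))) := by field_simp
    _ < exp s * (1 / (2 * √s)) := by
        gcongr 1
        rw [div_lt_div_iff₀ (by positivity) (by positivity)]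
        linarith
    _ = exp s / (2 * √s) := by ring

lemma besselI_zero_neg (s : ℝ) : besselI 0 (-s) = besselI 0 s := by
  have h := integral_comp_sub_left (a := 0) (b := π) (fun θ ↦ exp (s * cos θ)) π
  simp only [cos_pi_sub, sub_self, sub_zero, mul_neg] at h
  simp [besselI, h]

lemma integral_zero_two_pi_eq_two_mul {g : ℝ → ℝ} (hg : Continuous g)
    (hsymm : ∀ θ, g (2 * π - θ) = g θ) :
    ∫ θ in (0 : ℝ)..2 * π, g θ = 2 * ∫ θ in (0 : ℝ)..π, g θ := by
  have h := integral_comp_sub_left (a := 0) (b := π) g (2 * π)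
  simp only [hsymm] at h
  rw [← integral_add_adjacent_intervals (hg.intervalIntegrable 0 π) (hg.intervalIntegrable _ _), h]
  ring_nf

lemma circleMap_half_mul_add_inv {R : ℝ} (t θ : ℝ) :
    ((t / 2 : ℂ) * (circleMap 0 R θ + (circleMap 0 R θ)⁻¹)).re =
      t / 2 * (R + R⁻¹) * cos θ := by
  have h : (circleMap 0 R θ)⁻¹ = (R⁻¹ : ℝ) * Complex.exp ((-θ : ℝ) * Complex.I) := by
    simp [circleMap, ← Complex.exp_neg, mul_comm]
  have h2 : (t / 2 : ℂ) = ((t / 2 : ℝ) : ℂ) := by push_cast; rfl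
  rw [h, h2, Complex.re_ofReal_mul, Complex.add_re, Complex.re_ofReal_mul,
    Complex.exp_ofReal_mul_I_re, cos_neg, circleMap, zero_add, Complex.re_ofReal_mul,
    Complex.exp_ofReal_mul_I_re]
  ring

/-- The Cauchy estimate for the coefficients of the generating function `exp (t / 2 * (z + 1 / z))`
of the modified Bessel functions. -/
lemma abs_besselI_le (n : ℕ) (t : ℝ) {R : ℝ} (hR : 1 ≤ R) :
    |besselI n t| ≤ R⁻¹ ^ n * besselI 0 (t / 2 * (R + R⁻¹)) := by
  have hR0 : 0 < R := by linarith
  set f : ℂ → ℂ := fun z ↦ Complex.exp ((t / 2 : ℂ) * (z + z⁻¹)) * z⁻¹ ^ n with hf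
  have hdiff : ∀ z : ℂ, z ≠ 0 → DifferentiableAt ℂ f z := fun z hz ↦ by
    rw [hf]; fun_prop (disch := assumption)
  have hcirc : ∀ r : ℝ, 0 < r → (∮ z in C(0, r), (z - 0)⁻¹ • f z) =
      Complex.I * ∫ θ in (0 : ℝ)..2 * π, f (circleMap 0 r θ) := by
    intro r hr
    rw [circleIntegral, ← integral_const_mul]
    refine integral_congr fun θ _ ↦ ?_
    have hz : circleMap 0 r θ ≠ 0 := circleMap_ne_center hr.ne'
    simp only [deriv_circleMap, sub_zero, smul_eq_mul]
    field_simp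
  have hshift := Complex.circleIntegral_sub_center_inv_smul_eq_of_differentiable_on_annulus_off_countable
    (c := 0) one_pos hR (f := f) Set.countable_empty
    (fun z hz ↦ (hdiff z fun h ↦ by simp [h] at hz).continuousAt.continuousWithinAt)
    (fun z hz ↦ hdiff z fun h ↦ by simp [h] at hz)
  rw [hcirc R hR0, hcirc 1 one_pos] at hshift
  have hshift := mul_left_cancel₀ Complex.I_ne_zero hshift
  have hcont : Continuous fun θ ↦ f (circleMap 0 1 θ) := by
    rw [continuous_iff_continuousAt]
    intro θ
    exact (hdiff _ (circleMap_ne_center one_ne_zero)).continuousAt.comp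
      (continuous_circleMap 0 1).continuousAt
  have hre : (∫ θ in (0 : ℝ)..2 * π, f (circleMap 0 1 θ)).re = 2 * π * besselI n t := by
    have h1 : (∫ θ in (0 : ℝ)..2 * π, f (circleMap 0 1 θ)).re =
        ∫ θ in (0 : ℝ)..2 * π, (f (circleMap 0 1 θ)).re :=
      (Complex.reCLM.intervalIntegral_comp_comm (hcont.intervalIntegrable _ _)).symm
    have h2 : ∀ θ : ℝ, (f (circleMap 0 1 θ)).re = exp (t * cos θ) * cos (n * θ) := by
      intro θ
      have e1 : (circleMap 0 1 θ) = Complex.exp (θ * Complex.I) := by simp [circleMap]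
      have e2 : (t / 2 : ℂ) * (circleMap 0 1 θ + (circleMap 0 1 θ)⁻¹) =
          ((t * cos θ : ℝ) : ℂ) := by
        rw [e1, ← Complex.exp_neg, Complex.ofReal_mul, Complex.ofReal_cos, Complex.cos]
        ring_nf
      have e3 : (circleMap 0 1 θ)⁻¹ ^ n = Complex.exp (((-(n * θ) : ℝ) : ℂ) * Complex.I) := by
        rw [e1, ← Complex.exp_neg, ← Complex.exp_nat_mul]; push_cast; ring_nf
      simp only [hf]
      rw [e2, e3, ← Complex.ofReal_exp, Complex.re_ofReal_mul, Complex.exp_ofReal_mul_I_re, cos_neg]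
    rw [h1]
    simp only [h2]
    rw [integral_zero_two_pi_eq_two_mul (by fun_prop), besselI]
    · field_simp
    · intro θ
      have : (n : ℝ) * (2 * π - θ) = n * (2 * π) - n * θ := by ring
      rw [cos_two_pi_sub, this, cos_nat_mul_two_pi_sub]
  have hnorm : ‖∫ θ in (0 : ℝ)..2 * π, f (circleMap 0 R θ)‖ ≤
      2 * π * (R⁻¹ ^ n * besselI 0 (t / 2 * (R + R⁻¹))) := by
    refine (norm_integral_le_integral_norm (by positivity)).trans_eq ?_
    have h2 : ∀ θ : ℝ, ‖f (circleMap 0 R θ)‖ =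
        R⁻¹ ^ n * exp (t / 2 * (R + R⁻¹) * cos θ) := by
      intro θ
      simp only [hf]
      rw [norm_mul, Complex.norm_exp, circleMap_half_mul_add_inv, norm_pow, norm_inv,
        norm_circleMap_zero, abs_of_pos hR0, mul_comm]
    simp only [h2]
    rw [integral_const_mul, integral_zero_two_pi_eq_two_mul (by fun_prop), besselI]
    · simp; field_simp
    · intro θ; rw [cos_two_pi_sub]
  have h : 2 * π * |besselI n t| ≤ 2 * π * (R⁻¹ ^ n * besselI 0 (t / 2 * (R + R⁻¹))) := by
    rw [← abs_of_pos two_pi_pos, ← abs_mul, ← hre, ← hshift, abs_of_pos two_pi_pos]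
    exact (Complex.abs_re_le_norm _).trans hnorm
  exact le_of_mul_le_mul_left h two_pi_pos

/-- **Carlini's formula** (Lemma 3.6): a bound on the modified Bessel function
of the first kind. -/
theorem carlini (n : ℕ) (hn : 1 ≤ n) (t : ℝ) (ht : t ≠ 0) :
    |besselI n t| <
      Real.exp (Real.sqrt (t ^ 2 + (n : ℝ) ^ 2)) *
        (Real.sqrt (((n : ℝ) / t) ^ 2 + 1) - (n : ℝ) / |t|) ^ n /
        (2 * ((n : ℝ) ^ 2 + t ^ 2) ^ ((1 : ℝ) / 4)) := by
  have hn1 : (1 : ℝ) ≤ n := by exact_mod_cast hn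
  have ht0 : 0 < |t| := abs_pos.2 ht
  set s := √(t ^ 2 + (n : ℝ) ^ 2) with hs
  have hs2 : s ^ 2 = |t| ^ 2 + (n : ℝ) ^ 2 := by rw [sq_abs]; exact Real.sq_sqrt (by positivity)
  have hns : (n : ℝ) ≤ s := Real.le_sqrt_of_sq_le (by nlinarith)
  have hts : |t| ≤ s := Real.le_sqrt_of_sq_le (by rw [sq_abs]; nlinarith)
  set R := (n + s) / |t| with hR
  have hR1 : 1 ≤ R := by rw [hR, le_div_iff₀ ht0]; linarith
  have hRinv : R⁻¹ = (s - n) / |t| := by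
    rw [hR, inv_div, div_eq_div_iff (by positivity) ht0.ne']
    linear_combination -hs2
  have hsqrt : √(((n : ℝ) / t) ^ 2 + 1) = s / |t| := by
    rw [Real.sqrt_eq_iff_mul_self_eq_of_pos (by positivity), ← pow_two, div_pow, div_pow, hs2, ← sq_abs t]
    field_simp
    ring
  have hpow : ((n : ℝ) ^ 2 + t ^ 2) ^ ((1 : ℝ) / 4) = √s := by
    rw [hs, add_comm, Real.sqrt_eq_rpow, Real.sqrt_eq_rpow, ← Real.rpow_mul (by positivity)]
    norm_num
  have hI : besselI 0 (t / 2 * (R + R⁻¹)) = besselI 0 s := by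
    have h : R + R⁻¹ = 2 * s / |t| := by rw [hRinv, hR]; ring
    rw [h]
    rcases abs_cases t with ⟨h, _⟩ | ⟨h, _⟩
    · rw [h]; congr 1; field_simp
    · rw [h, ← besselI_zero_neg s]; congr 1; field_simp
  have hRpos : 0 < R⁻¹ ^ n := by positivity
  calc |besselI n t| ≤ R⁻¹ ^ n * besselI 0 s := hI ▸ abs_besselI_le n t hR1
    _ < R⁻¹ ^ n * (exp s / (2 * √s)) := by
        gcongr; exact besselI_zero_lt (hn1.trans hns)
    _ = _ := by rw [hsqrt, hpow, ← sub_div, ← hRinv]; ring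
end

section
/- There exist universal constants C₁, C₂ ≥ 1 with the following property. For every ε ∈ (0, 1) and every real β ≥ 1, there exists a polynomial p ∈ ℝ[X] of degree at most C₁·β·log(β/ε) such that |p(x)| ≤ C₂ for all x ∈ [−1, 1] and |p(x) − exp(β·x)| ≤ ε for all x ∈ [−1, 0]. -/
open Real Polynomial

/-- Convolving a polynomial with a continuous weight on a compact interval yields a polynomial
of no larger degree. -/
lemma exists_polynomial_eval_eq_integral (K : ℝ[X]) {f : ℝ → ℝ} (hf : Continuous f) (a b : ℝ) :
    ∃ p : ℝ[X], p.natDegree ≤ K.natDegree ∧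
      ∀ x, p.eval x = ∫ u in (x - b)..(x - a), f (x - u) * K.eval u := by
  refine ⟨∑ i ∈ Finset.range (K.natDegree + 1),
    C (∫ s in a..b, f s * (hasseDeriv i K).eval (-s)) * X ^ i, ?_, fun x => ?_⟩
  · refine natDegree_sum_le_of_forall_le _ _ fun i hi => ?_
    exact (natDegree_C_mul_X_pow_le _ _).trans (Nat.lt_succ_iff.mp (Finset.mem_range.mp hi))
  · have hsub := intervalIntegral.integral_comp_sub_left
      (fun u => f (x - u) * K.eval u) (a := a) (b := b) x
    rw [← hsub]
    simp only [eval_finsetSum, eval_mul, eval_C, eval_pow, eval_X, sub_sub_cancel]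
    have hK (s : ℝ) : f s * K.eval (x - s) = ∑ i ∈ Finset.range (K.natDegree + 1),
        f s * (hasseDeriv i K).eval (-s) * x ^ i := by
      rw [sub_eq_add_neg, ← taylor_eval, eval_eq_sum_range, natDegree_taylor, Finset.mul_sum]
      simp only [taylor_coeff, mul_assoc]
    simp only [hK]
    rw [intervalIntegral.integral_finsetSum]
    · simp only [intervalIntegral.integral_mul_const]
    · intro i _
      apply Continuous.intervalIntegrable
      fun_prop

/-- A nonnegative kernel concentrated on `[-β⁻¹, β⁻¹]` yields, by convolution with
`s ↦ exp (β * s)` cut off at `β⁻¹`, an approximation of the exponential. -/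
lemma exists_approx_exp_of_kernel {K : ℝ[X]} {ε β : ℝ} (hε : 0 < ε) (hε1 : ε < 1) (hβ : 1 ≤ β)
    (hK0 : ∀ u, 0 ≤ K.eval u) (hK1 : ∀ u, β⁻¹ ≤ |u| → |u| ≤ 3 → K.eval u ≤ 1)
    (hKc : 3 * exp 1 / ε ≤ ∫ u in (-β⁻¹)..β⁻¹, exp (-(β * u)) * K.eval u) :
    ∃ p : ℝ[X], p.natDegree ≤ K.natDegree ∧
      (∀ x ∈ Set.Icc (-1 : ℝ) 1, |p.eval x| ≤ exp 2 + 1) ∧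
      ∀ x ∈ Set.Icc (-1 : ℝ) 0, |p.eval x - exp (β * x)| ≤ ε := by
  obtain ⟨q, hqdeg, hq⟩ := exists_polynomial_eval_eq_integral K
    (f := fun s => exp (β * s)) (by fun_prop) (-2) β⁻¹
  set δ := β⁻¹ with hδ
  set c := ∫ u in (-δ)..δ, exp (-(β * u)) * K.eval u with hc
  have hβ0 : 0 < β := by linarith
  have hδ0 : 0 < δ := inv_pos.mpr hβ0
  have hδ1 : δ ≤ 1 := inv_le_one_of_one_le₀ hβ
  have hβδ : β * δ = 1 := mul_inv_cancel₀ hβ0.ne'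
  have he : 0 < exp 1 := exp_pos 1
  have hc0 : 0 < c := lt_of_lt_of_le (by positivity) hKc
  have hεc : 3 * exp 1 ≤ ε * c := by rwa [div_le_iff₀' hε] at hKc
  have hint (x a b : ℝ) : IntervalIntegrable (fun u => exp (β * (x - u)) * K.eval u)
      MeasureTheory.volume a b := Continuous.intervalIntegrable (by fun_prop) _ _
  have htail_nonneg (x : ℝ) {a b : ℝ} (hab : a ≤ b) :
      0 ≤ ∫ u in a..b, exp (β * (x - u)) * K.eval u :=
    intervalIntegral.integral_nonneg hab fun u _ => mul_nonneg (exp_pos _).le (hK0 u)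
  have hexp_le {x u : ℝ} (hu : x - δ ≤ u) : exp (β * (x - u)) ≤ exp 1 := by
    apply exp_le_exp.mpr
    calc β * (x - u) ≤ β * δ := by gcongr; linarith
      _ = 1 := hβδ
  have htail_le {x a b : ℝ} (hab : a ≤ b) (hxa : x - δ ≤ a)
      (hu : ∀ u ∈ Set.Icc a b, δ ≤ |u| ∧ |u| ≤ 3) :
      ∫ u in a..b, exp (β * (x - u)) * K.eval u ≤ exp 1 * (b - a) := by
    calc ∫ u in a..b, exp (β * (x - u)) * K.eval u ≤ ∫ _ in a..b, exp 1 := by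
          refine intervalIntegral.integral_mono_on hab (hint _ _ _) (by simp) fun u hu' => ?_
          have h1 := hexp_le (hxa.trans hu'.1)
          have h2 := hK1 u (hu u hu').1 (hu u hu').2
          calc exp (β * (x - u)) * K.eval u ≤ exp 1 * 1 := by
                gcongr
                exact hK0 u
            _ = exp 1 := mul_one _
      _ = exp 1 * (b - a) := by simp [mul_comm]
  have hcore (x : ℝ) : ∫ u in (-δ)..δ, exp (β * (x - u)) * K.eval u = exp (β * x) * c := by
    rw [hc, ← intervalIntegral.integral_const_mul]
    refine intervalIntegral.integral_congr fun u _ => ?_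
    simp only [← mul_assoc, ← exp_add]
    ring_nf
  have happrox : ∀ x ∈ Set.Icc (-1 : ℝ) 0, |c⁻¹ * q.eval x - exp (β * x)| ≤ ε := by
    rintro x ⟨hx1, hx0⟩
    have hsplit : q.eval x = (∫ u in (x - δ)..(-δ), exp (β * (x - u)) * K.eval u)
        + exp (β * x) * c + ∫ u in δ..(x - -2), exp (β * (x - u)) * K.eval u := by
      rw [hq, ← hcore,
        intervalIntegral.integral_add_adjacent_intervals (hint _ _ _) (hint _ _ _),
        intervalIntegral.integral_add_adjacent_intervals (hint _ _ _) (hint _ _ _)]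
    have hl := htail_le (x := x) (a := x - δ) (b := -δ) (by linarith) le_rfl fun u hu => by
      rw [abs_of_nonpos (by linarith [hu.2])]
      constructor <;> linarith [hu.1, hu.2]
    have hr := htail_le (x := x) (a := δ) (b := x - -2) (by linarith) (by linarith)
      fun u hu => by
        rw [abs_of_nonneg (by linarith [hu.1])]
        constructor <;> linarith [hu.1, hu.2]
    have hl0 := htail_nonneg x (a := x - δ) (b := -δ) (by linarith)
    have hr0 := htail_nonneg x (a := δ) (b := x - -2) (by linarith)
    have heq : c⁻¹ * q.eval x - exp (β * x) =
        ((∫ u in (x - δ)..(-δ), exp (β * (x - u)) * K.eval u)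
          + ∫ u in δ..(x - -2), exp (β * (x - u)) * K.eval u) / c := by
      rw [hsplit]
      field_simp
      ring
    rw [heq, abs_of_nonneg (by positivity), div_le_iff₀ hc0]
    nlinarith
  refine ⟨C c⁻¹ * q, (natDegree_C_mul_le _ _).trans hqdeg, ?_, by simpa using happrox⟩
  rintro x ⟨hx1, hx2⟩
  rw [eval_mul, eval_C]
  rcases le_total x 0 with hx0 | hx0
  · have h1 := abs_le.mp (happrox x ⟨hx1, hx0⟩)
    have h2 : exp (β * x) ≤ 1 := exp_le_one_iff.mpr (mul_nonpos_of_nonneg_of_nonpos hβ0.le hx0)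
    have h3 := exp_pos (β * x)
    have h4 : 1 ≤ exp 2 := one_le_exp (by norm_num)
    rw [abs_le]
    constructor <;> linarith
  · have hKint (a b : ℝ) : IntervalIntegrable (fun u => K.eval u) MeasureTheory.volume a b :=
      Continuous.intervalIntegrable (by fun_prop) _ _
    have hmass : ∫ u in (-δ)..δ, K.eval u ≤ exp 1 * c := by
      rw [hc, ← intervalIntegral.integral_const_mul]
      refine intervalIntegral.integral_mono_on (by linarith) (hKint _ _)
        (Continuous.intervalIntegrable (by fun_prop) _ _) fun u hu => ?_
      rw [← mul_assoc, ← exp_add]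
      refine le_mul_of_one_le_left (hK0 u) (one_le_exp ?_)
      nlinarith [hu.2]
    have hhead : ∫ u in (x - δ)..(max δ (x - δ)), exp (β * (x - u)) * K.eval u
        ≤ exp 1 * (exp 1 * c) := by
      rcases le_total (x - δ) δ with h | h
      · rw [max_eq_left h]
        calc ∫ u in (x - δ)..δ, exp (β * (x - u)) * K.eval u
            ≤ ∫ u in (x - δ)..δ, exp 1 * K.eval u := by
              refine intervalIntegral.integral_mono_on h (hint _ _ _)
                ((hKint _ _).const_mul _) fun u hu => ?_
              exact mul_le_mul_of_nonneg_right (hexp_le hu.1) (hK0 u)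
          _ = exp 1 * ∫ u in (x - δ)..δ, K.eval u := intervalIntegral.integral_const_mul _ _
          _ ≤ exp 1 * ∫ u in (-δ)..δ, K.eval u := by
              gcongr
              exact intervalIntegral.integral_mono_interval (by linarith) h le_rfl
                (Filter.Eventually.of_forall hK0) (hKint _ _)
          _ ≤ exp 1 * (exp 1 * c) := by gcongr
      · rw [max_eq_right h, intervalIntegral.integral_same]
        positivity
    have hmax : max δ (x - δ) ≤ x - -2 := max_le (by linarith) (by linarith)
    have htail := htail_le (x := x) hmax (le_max_right _ _) fun u hu => by
      have := (le_max_left _ _).trans hu.1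
      rw [abs_of_nonneg (by linarith)]
      constructor <;> linarith [hu.2]
    have hδmax : δ ≤ max δ (x - δ) := le_max_left _ _
    have hq0 : 0 ≤ q.eval x := by
      rw [hq]
      exact htail_nonneg x (by linarith)
    have hqle : q.eval x ≤ (exp 2 + 1) * c := by
      rw [hq, ← intervalIntegral.integral_add_adjacent_intervals
        (hint _ _ (max δ (x - δ))) (hint _ _ _)]
      have h2 : exp 2 = exp 1 * exp 1 := by rw [← exp_add]; norm_num
      rw [h2]
      nlinarith
    rw [abs_of_nonneg (by positivity), inv_mul_le_iff₀ hc0]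
    linarith

lemma cosh_mul_le_eval_T (n : ℕ) {t w : ℝ} (ht : 0 ≤ t) (hw : cosh t ≤ w) :
    cosh (n * t) ≤ (Chebyshev.T ℝ n).eval w := by
  have hw1 : 1 ≤ w := (one_le_cosh t).trans hw
  have ht' : t ≤ arcosh w := by
    rw [← arcosh_cosh ht]
    exact (arcosh_le_arcosh (cosh_pos t) (by linarith)).mpr hw
  rw [← cosh_arcosh hw1, Chebyshev.T_real_cosh, cosh_le_cosh, Int.cast_natCast,
    abs_of_nonneg (by positivity), abs_of_nonneg (by positivity [arcosh_nonneg hw1])]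
  gcongr

/-- The kernel is the square of a Chebyshev polynomial composed with a quadratic which exceeds
`1` exactly on the interval `(-δ, δ)`. -/
lemma exists_concentrated_kernel (n : ℕ) {δ : ℝ} (hδ0 : 0 < δ) (hδ1 : δ ≤ 1) :
    ∃ K : ℝ[X], K.natDegree ≤ 4 * n ∧ (∀ u, 0 ≤ K.eval u) ∧
      (∀ u, δ ≤ |u| → |u| ≤ 3 → K.eval u ≤ 1) ∧
      ∀ u, |u| ≤ δ / 2 → exp (2 * n * (δ / 3)) / 4 ≤ K.eval u := by
  refine ⟨((Chebyshev.T ℝ n).comp (C (1 + 2 / 9 * δ ^ 2) - C (2 / 9) * X ^ 2)) ^ 2,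
    ?_, fun u => ?_, fun u hu hu3 => ?_, fun u hu => ?_⟩
  · have h : (C (1 + 2 / 9 * δ ^ 2) - C (2 / 9) * X ^ 2 : ℝ[X]).natDegree ≤ 2 := by
      compute_degree
    refine natDegree_pow_le.trans ?_
    rw [natDegree_comp, Chebyshev.natDegree_T, Int.natAbs_natCast]
    calc 2 * (n * _) ≤ 2 * (n * 2) := by gcongr
      _ = 4 * n := by ring
  · rw [eval_pow]
    positivity
  · have h1 : δ ^ 2 ≤ u ^ 2 := by rw [← sq_abs u]; gcongr
    have h2 : u ^ 2 ≤ 3 ^ 2 := by rw [← sq_abs u]; gcongr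
    simp only [eval_pow, eval_comp, eval_sub, eval_mul, eval_C, eval_X]
    rw [sq_le_one_iff_abs_le_one]
    apply Chebyshev.abs_eval_T_real_le_one
    rw [abs_le]
    constructor <;> nlinarith
  · have h1 : u ^ 2 ≤ (δ / 2) ^ 2 := by rw [← sq_abs u]; gcongr
    simp only [eval_pow, eval_comp, eval_sub, eval_mul, eval_C, eval_X]
    have hδ2 : δ ^ 2 ≤ 1 := by nlinarith
    have hcosh : cosh (δ / 3) ≤ 1 + δ ^ 2 / 6 := by
      have h3 := (abs_le.mp (abs_exp_sub_one_sub_id_le (x := (δ / 3) ^ 2 / 2)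
        (by rw [abs_of_nonneg (by positivity)]; nlinarith))).2
      have h4 := cosh_le_exp_half_sq (δ / 3)
      nlinarith
    have hT := cosh_mul_le_eval_T n (t := δ / 3)
      (w := 1 + 2 / 9 * δ ^ 2 - 2 / 9 * u ^ 2) (by positivity) (by linarith)
    have hexp : exp (n * (δ / 3)) / 2 ≤ cosh (n * (δ / 3)) := by
      rw [cosh_eq]
      linarith [exp_pos (-(n * (δ / 3)))]
    calc exp (2 * n * (δ / 3)) / 4 = (exp (n * (δ / 3)) / 2) ^ 2 := by
          rw [div_pow, ← exp_nat_mul]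
          norm_num
          ring_nf
      _ ≤ _ := by gcongr; exact hexp.trans hT

/-- **Bounded polynomial approximation of the exponential**
(Corollary 3.13): for `β ≥ 1` there is a polynomial of degree
`O(β log(β/ε))`, bounded by a constant on `[-1, 1]` and `ε`-close to
`exp(βx)` on `[-1, 0]`. -/
theorem exp_bounded_approx :
    ∃ C₁ C₂ : ℝ, 1 ≤ C₁ ∧ 1 ≤ C₂ ∧
      ∀ ε β : ℝ, 0 < ε → ε < 1 → 1 ≤ β →
        ∃ p : Polynomial ℝ,
          (p.natDegree : ℝ) ≤ C₁ * β * Real.log (β / ε) ∧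
          (∀ x : ℝ, x ∈ Set.Icc (-1 : ℝ) 1 → |p.eval x| ≤ C₂) ∧
          (∀ x : ℝ, x ∈ Set.Icc (-1 : ℝ) 0 → |p.eval x - Real.exp (β * x)| ≤ ε) := by
  refine ⟨56, exp 2 + 1, by norm_num, by linarith [exp_pos 2], fun ε β hε hε1 hβ => ?_⟩
  have hβ0 : 0 < β := by linarith
  rcases le_total (1 / 2) ε with hhalf | hhalf
  · refine ⟨C (1 / 2), ?_, fun x _ => ?_, fun x hx => ?_⟩
    · rw [natDegree_C, Nat.cast_zero]
      have : 0 ≤ log (β / ε) := log_nonneg (by rw [le_div_iff₀ hε]; linarith)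
      positivity
    · rw [eval_C, abs_of_pos (by norm_num)]
      linarith [exp_pos 2]
    · have h1 : exp (β * x) ≤ 1 :=
        exp_le_one_iff.mpr (mul_nonpos_of_nonneg_of_nonpos hβ0.le hx.2)
      have h2 := exp_pos (β * x)
      rw [eval_C, abs_le]
      constructor <;> linarith
  set L := log (β / ε) with hL
  have hratio : 2 ≤ β / ε := by rw [le_div_iff₀ hε]; linarith
  have hL2 : log 2 ≤ L := log_le_log (by norm_num) hratio
  have hlog2 := log_two_gt_d9
  have hexpL : exp L = β / ε := exp_log (by positivity)
  set n := ⌈12 * β * L⌉₊ with hn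
  have hn_ge : 12 * β * L ≤ n := Nat.le_ceil _
  have hβL : L ≤ β * L := le_mul_of_one_le_left (by linarith) hβ
  have hn_le : (n : ℝ) ≤ 14 * β * L := by
    have := Nat.ceil_lt_add_one (a := 12 * β * L) (by nlinarith)
    linarith
  have hδ0 : 0 < β⁻¹ := inv_pos.mpr hβ0
  obtain ⟨K, hKdeg, hK0, hK1, hKcore⟩ :=
    exists_concentrated_kernel n hδ0 (inv_le_one_of_one_le₀ hβ)
  have hpeak : 3 * exp 1 ^ 2 * (β / ε) ≤ exp (2 * n * (β⁻¹ / 3)) / 4 := by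
    have h1 : 8 * L ≤ 2 * n * (β⁻¹ / 3) := by
      calc 8 * L = 2 * (12 * β * L) * (β⁻¹ / 3) := by field_simp; ring
        _ ≤ _ := by gcongr
    have h2 : (2 : ℝ) ^ 7 ≤ exp L ^ 7 := by rw [hexpL]; gcongr
    have h3 : exp 1 ^ 2 ≤ 8 := by nlinarith [exp_one_lt_d9, exp_pos 1]
    have h4 : exp L ^ 7 * exp L ≤ exp (2 * n * (β⁻¹ / 3)) := by
      rw [← pow_succ, ← exp_nat_mul]
      exact exp_le_exp.mpr (by push_cast; linarith)
    rw [hexpL] at h4 h2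
    have h5 : 0 < β / ε := by positivity
    nlinarith
  have hKc : 3 * exp 1 / ε ≤ ∫ u in (-β⁻¹)..β⁻¹, exp (-(β * u)) * K.eval u := by
    have hint (a b : ℝ) : IntervalIntegrable (fun u => exp (-(β * u)) * K.eval u)
        MeasureTheory.volume a b := Continuous.intervalIntegrable (by fun_prop) _ _
    calc 3 * exp 1 / ε
        = ∫ _ in (-(β⁻¹ / 2))..(β⁻¹ / 2), exp (-1) * (3 * exp 1 ^ 2 * (β / ε)) := by
          rw [intervalIntegral.integral_const, smul_eq_mul, exp_neg]
          field_simp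
          ring
      _ ≤ ∫ u in (-(β⁻¹ / 2))..(β⁻¹ / 2), exp (-(β * u)) * K.eval u := by
          refine intervalIntegral.integral_mono_on (by linarith) (by simp) (hint _ _)
            fun u hu => ?_
          have hu' := hKcore u (abs_le.mpr hu)
          have hβu : β * u ≤ 1 := by
            calc β * u ≤ β * β⁻¹ := by gcongr; linarith [hu.2]
              _ = 1 := mul_inv_cancel₀ hβ0.ne'
          gcongr
          exact hpeak.trans hu'
      _ ≤ ∫ u in (-β⁻¹)..β⁻¹, exp (-(β * u)) * K.eval u :=
          intervalIntegral.integral_mono_interval (by linarith) (by linarith) (by linarith)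
            (Filter.Eventually.of_forall fun u => mul_nonneg (exp_pos _).le (hK0 u)) (hint _ _)
  obtain ⟨p, hpdeg, hp⟩ := exists_approx_exp_of_kernel hε hε1 hβ hK0 hK1 hKc
  refine ⟨p, ?_, hp⟩
  calc (p.natDegree : ℝ) ≤ 4 * n := mod_cast hpdeg.trans hKdeg
    _ ≤ 56 * β * L := by linarith
end

section
/- There exists a universal constant C ≥ 1 with the following property. For every ε ∈ (0, 1) and every t ∈ [−1, 1], there exist an even polynomial p ∈ ℝ[X] (p(−x) = p(x) for all x) and an odd polynomial q ∈ ℝ[X] (q(−x) = −q(x) for all x), each of degree at most C·log(1/ε), such that |p(x)| ≤ 1 and |q(x)| ≤ 1 for all x ∈ [−1, 1], and |p(x) − cos(t·arcsin(x))| ≤ ε and |q(x) − sin(t·arcsin(x))| ≤ ε for all x ∈ [−1/2, 1/2]. -/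
open Real Polynomial

lemma abs_arcsin_le_pi_div_six {x : ℝ} (hx : x ∈ Set.Icc (-(1 / 2) : ℝ) (1 / 2)) :
    |arcsin x| ≤ π / 6 := by
  have hpi := pi_pos
  rw [abs_le]
  constructor
  · rw [le_arcsin_iff_sin_le ⟨by linarith, by linarith⟩
      ⟨by linarith [hx.1], by linarith [hx.2]⟩, sin_neg, sin_pi_div_six]
    exact hx.1
  · rw [arcsin_le_iff_le_sin ⟨by linarith [hx.1], by linarith [hx.2]⟩
      ⟨by linarith, by linarith⟩, sin_pi_div_six]
    exact hx.2

/-- The sine of an angle of absolute value at most `π / 6` lies in `[-1/2, 1/2]`. -/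
lemma sin_mem_Icc_of_abs_le_pi_div_six {y : ℝ} (hy : |y| ≤ π / 6) :
    sin y ∈ Set.Icc (-(1 / 2) : ℝ) (1 / 2) := by
  have hpi := pi_pos
  have hy' := abs_le.1 hy
  have h1 := sin_le_sin_of_le_of_le_pi_div_two (x := -(π / 6)) (y := y)
    (by linarith) (by linarith) hy'.1
  have h2 := sin_le_sin_of_le_of_le_pi_div_two (x := y) (y := π / 6)
    (by linarith) (by linarith) hy'.2
  rw [sin_neg, sin_pi_div_six] at h1
  rw [sin_pi_div_six] at h2
  exact ⟨h1, h2⟩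

/-- A function with vanishing initial data at `0` and `|f'' + t² f| ≤ M` near `0` is at most
`2 * M` there. -/
lemma abs_le_of_abs_oscillator_le {f f' f'' : ℝ → ℝ} {t M r : ℝ} (hr : r ≤ 1)
    (hf : ∀ x, HasDerivAt f (f' x) x) (hf' : ∀ x, HasDerivAt f' (f'' x) x)
    (h0 : f 0 = 0) (h0' : f' 0 = 0)
    (hM : ∀ x ∈ Set.Icc (-r) r, |f'' x + t ^ 2 * f x| ≤ M) {x : ℝ} (hx : x ∈ Set.Icc (-r) r) :
    |f x| ≤ 2 * M := by
  have hr0 : 0 ≤ r := by linarith [hx.1, hx.2]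
  have z0 : (0 : ℝ) ∈ Set.Icc (-r) r := ⟨by linarith, hr0⟩
  have hM0 : 0 ≤ M := (abs_nonneg _).trans (hM 0 z0)
  have habs : ∀ y ∈ Set.Icc (-r) r, |y| ≤ 1 := fun y hy => (abs_le.2 hy).trans hr
  have hlin : ∀ y : ℝ, HasDerivAt (fun y => t * y) t y := fun y => by
    simpa using (hasDerivAt_id y).const_mul t
  have hA : ∀ y, HasDerivAt (fun y => f' y * cos (t * y) + t * f y * sin (t * y))
      ((f'' y + t ^ 2 * f y) * cos (t * y)) y := fun y =>
    (((hf' y).mul (hlin y).cos).add (((hf y).const_mul t).mul (hlin y).sin)).congr_deriv (by ring)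
  have hB : ∀ y, HasDerivAt (fun y => f' y * sin (t * y) - t * f y * cos (t * y))
      ((f'' y + t ^ 2 * f y) * sin (t * y)) y := fun y =>
    (((hf' y).mul (hlin y).sin).sub (((hf y).const_mul t).mul (hlin y).cos)).congr_deriv (by ring)
  have hAbd : ∀ y ∈ Set.Icc (-r) r, |f' y * cos (t * y) + t * f y * sin (t * y)| ≤ M := by
    intro y hy
    have := (convex_Icc (-r) r).norm_image_sub_le_of_norm_hasDerivWithin_le (C := M)
      (fun z _ => (hA z).hasDerivWithinAt) (fun z hz => by
        rw [norm_eq_abs, abs_mul]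
        exact (mul_le_of_le_one_right (abs_nonneg _) (abs_cos_le_one _)).trans (hM z hz)) z0 hy
    simp only [h0, h0', norm_eq_abs, zero_mul, mul_zero, add_zero, sub_zero] at this
    exact this.trans (mul_le_of_le_one_right hM0 (habs y hy))
  have hBbd : ∀ y ∈ Set.Icc (-r) r, |f' y * sin (t * y) - t * f y * cos (t * y)| ≤ M := by
    intro y hy
    have := (convex_Icc (-r) r).norm_image_sub_le_of_norm_hasDerivWithin_le (C := M)
      (fun z _ => (hB z).hasDerivWithinAt) (fun z hz => by
        rw [norm_eq_abs, abs_mul]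
        exact (mul_le_of_le_one_right (abs_nonneg _) (abs_sin_le_one _)).trans (hM z hz)) z0 hy
    simp only [h0, h0', norm_eq_abs, zero_mul, mul_zero, sub_zero] at this
    exact this.trans (mul_le_of_le_one_right hM0 (habs y hy))
  have hf'bd : ∀ y ∈ Set.Icc (-r) r, ‖f' y‖ ≤ 2 * M := by
    intro y hy
    have key : f' y = (f' y * cos (t * y) + t * f y * sin (t * y)) * cos (t * y)
        + (f' y * sin (t * y) - t * f y * cos (t * y)) * sin (t * y) := by
      linear_combination (-f' y) * sin_sq_add_cos_sq (t * y)
    rw [norm_eq_abs, key]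
    refine (abs_add_le _ _).trans ?_
    rw [abs_mul, abs_mul]
    have h1 := mul_le_of_le_one_right
      (abs_nonneg (f' y * cos (t * y) + t * f y * sin (t * y))) (abs_cos_le_one (t * y))
    have h2 := mul_le_of_le_one_right
      (abs_nonneg (f' y * sin (t * y) - t * f y * cos (t * y))) (abs_sin_le_one (t * y))
    linarith [hAbd y hy, hBbd y hy]
  have := (convex_Icc (-r) r).norm_image_sub_le_of_norm_hasDerivWithin_le
    (fun z _ => (hf z).hasDerivWithinAt) hf'bd z0 hx
  simp only [h0, norm_eq_abs, sub_zero] at this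
  exact this.trans (mul_le_of_le_one_right (by linarith) (habs x hx))

/-- A polynomial that nearly solves the Chebyshev-type equation `(1 - x²) P'' - x P' + t² P = 0`
on `[-1/2, 1/2]` is close there to the solution with the same initial data. -/
lemma abs_eval_sub_trig_arcsin_le (P : ℝ[X]) {t M α β : ℝ} (h0 : P.eval 0 = α)
    (h0' : (derivative P).eval 0 = t * β)
    (hM : ∀ x ∈ Set.Icc (-(1 / 2) : ℝ) (1 / 2),
      |(1 - x ^ 2) * (derivative (derivative P)).eval x - x * (derivative P).eval x
        + t ^ 2 * P.eval x| ≤ M) {x : ℝ} (hx : x ∈ Set.Icc (-(1 / 2) : ℝ) (1 / 2)) :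
    |P.eval x - (α * cos (t * arcsin x) + β * sin (t * arcsin x))| ≤ 2 * M := by
  have hpi := pi_le_four
  have hlin : ∀ y : ℝ, HasDerivAt (fun y => t * y) t y := fun y => by
    simpa using (hasDerivAt_id y).const_mul t
  have hf : ∀ y, HasDerivAt
      (fun y => P.eval (sin y) - (α * cos (t * y) + β * sin (t * y)))
      ((derivative P).eval (sin y) * cos y
        - (α * (-sin (t * y) * t) + β * (cos (t * y) * t))) y := fun y =>
    ((P.hasDerivAt (sin y)).comp y (hasDerivAt_sin y)).sub
      (((hlin y).cos.const_mul α).add ((hlin y).sin.const_mul β))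
  have hf' : ∀ y, HasDerivAt
      (fun y => (derivative P).eval (sin y) * cos y
        - (α * (-sin (t * y) * t) + β * (cos (t * y) * t)))
      ((derivative (derivative P)).eval (sin y) * cos y * cos y
        + (derivative P).eval (sin y) * (-sin y)
        - (α * (-(cos (t * y) * t) * t) + β * (-sin (t * y) * t * t))) y := fun y =>
    ((((derivative P).hasDerivAt (sin y)).comp y (hasDerivAt_sin y)).mul (hasDerivAt_cos y)).sub
      ((((hlin y).sin.neg.mul_const t).const_mul α).add
        (((hlin y).cos.mul_const t).const_mul β))
  have hsin : sin (arcsin x) = x := sin_arcsin (by linarith [hx.1]) (by linarith [hx.2])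
  have := abs_le_of_abs_oscillator_le (t := t) (M := M) (r := π / 6) (by linarith) hf hf'
    (by simp [h0]) (by simp [h0']; ring) (fun y hy => by
      refine le_of_eq_of_le (congrArg _ ?_)
        (hM (sin y) (sin_mem_Icc_of_abs_le_pi_div_six (abs_le.2 hy)))
      linear_combination
        (derivative (derivative P)).eval (sin y) * sin_sq_add_cos_sq y)
    (abs_le.1 (abs_arcsin_le_pi_div_six hx))
  simpa only [hsin] using this

/-- The Taylor coefficients of `cos (t * arcsin x)` (for `e = 0`) and of
`sin (t * arcsin x) / t` (for `e = 1`): the coefficient of `x ^ (2 * n + e)`. -/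
noncomputable def trigArcsinCoeff (t : ℝ) (e : ℕ) : ℕ → ℝ
  | 0 => 1
  | n + 1 => ((2 * n + e : ℝ) ^ 2 - t ^ 2) / ((2 * n + e + 1) * (2 * n + e + 2))
      * trigArcsinCoeff t e n

/-- The Taylor polynomials with coefficients `trigArcsinCoeff`. -/
noncomputable def trigArcsinPoly (t : ℝ) (e n : ℕ) : ℝ[X] :=
  ∑ j ∈ Finset.range (n + 1), C (trigArcsinCoeff t e j) * X ^ (2 * j + e)

lemma trigArcsinPoly_zero (t : ℝ) (e : ℕ) : trigArcsinPoly t e 0 = X ^ e := by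
  simp [trigArcsinPoly, trigArcsinCoeff]

lemma trigArcsinPoly_succ (t : ℝ) (e n : ℕ) :
    trigArcsinPoly t e (n + 1) = trigArcsinPoly t e n
      + C (trigArcsinCoeff t e (n + 1)) * X ^ (2 * n + e + 2) := by
  rw [trigArcsinPoly, Finset.sum_range_succ, trigArcsinPoly,
    show 2 * (n + 1) + e = 2 * n + e + 2 by ring]

lemma natDegree_trigArcsinPoly_le (t : ℝ) (e n : ℕ) :
    (trigArcsinPoly t e n).natDegree ≤ 2 * n + e := by
  refine natDegree_sum_le_of_forall_le _ _ fun j hj => (natDegree_C_mul_X_pow_le _ _).trans ?_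
  have := Finset.mem_range.1 hj
  omega

lemma eval_neg_trigArcsinPoly (t : ℝ) (e n : ℕ) (x : ℝ) :
    (trigArcsinPoly t e n).eval (-x) = (-1) ^ e * (trigArcsinPoly t e n).eval x := by
  simp only [trigArcsinPoly, eval_finsetSum, Finset.mul_sum]
  refine Finset.sum_congr rfl fun j _ => ?_
  simp only [eval_mul, eval_C, eval_pow, eval_X]
  rw [neg_pow, pow_add (-1 : ℝ), pow_mul]
  norm_num
  ring

lemma trigArcsinCoeff_succ_mul (t : ℝ) (e n : ℕ) :
    trigArcsinCoeff t e (n + 1) * ((2 * n + e + 1) * (2 * n + e + 2))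
      = ((2 * n + e : ℝ) ^ 2 - t ^ 2) * trigArcsinCoeff t e n := by
  have h : ((2 * n + e + 1 : ℝ) * (2 * n + e + 2)) ≠ 0 := by positivity
  rw [trigArcsinCoeff]
  field_simp

/-- The residual of the Taylor polynomials in the equation satisfied by their limit. -/
lemma trigArcsinPoly_residual (t : ℝ) {e : ℕ} (he : e ≤ 1) (n : ℕ) (x : ℝ) :
    (1 - x ^ 2) * (derivative (derivative (trigArcsinPoly t e n))).eval x
        - x * (derivative (trigArcsinPoly t e n)).eval x + t ^ 2 * (trigArcsinPoly t e n).eval x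
      = -(((2 * n + e : ℝ) ^ 2 - t ^ 2) * trigArcsinCoeff t e n * x ^ (2 * n + e)) := by
  induction n with
  | zero =>
    rw [trigArcsinPoly_zero]
    interval_cases e <;> (simp [trigArcsinCoeff]; try ring)
  | succ n ih =>
    have h := trigArcsinCoeff_succ_mul t e n
    rw [trigArcsinPoly_succ, show 2 * (n + 1) + e = 2 * n + e + 2 by ring]
    simp only [derivative_add, derivative_mul, derivative_C, zero_mul, zero_add, derivative_X_pow,
      eval_add, eval_mul, eval_C, eval_pow, eval_X, eval_natCast, map_natCast,
      derivative_natCast, Nat.add_sub_cancel, show 2 * n + e + 2 - 1 = 2 * n + e + 1 by omega]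
    push_cast
    linear_combination ih + x ^ (2 * n + e) * h

lemma abs_trigArcsinCoeff_le_one {t : ℝ} (ht : |t| ≤ 1) (e n : ℕ) :
    |trigArcsinCoeff t e n| ≤ 1 := by
  have ht2 : t ^ 2 ≤ 1 := (sq_le_one_iff_abs_le_one t).2 ht
  induction n with
  | zero => simp [trigArcsinCoeff]
  | succ n ih =>
    rw [trigArcsinCoeff, abs_mul]
    refine mul_le_one₀ ?_ (abs_nonneg _) ih
    have hk : (0 : ℝ) ≤ 2 * n + e := by positivity
    rw [abs_div, abs_of_pos (a := (2 * n + e + 1 : ℝ) * (2 * n + e + 2)) (by positivity),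
      div_le_one (by positivity), abs_le]
    constructor <;> nlinarith [sq_nonneg t]

lemma trigArcsinPoly_even_bounds {t x : ℝ} (ht : |t| ≤ 1) (hx : |x| ≤ 1) (n : ℕ) :
    trigArcsinCoeff t 0 (n + 1) ≤ 0 ∧
      1 - 3 / 2 * t ^ 2 - 2 * (n + 1) * trigArcsinCoeff t 0 (n + 1)
        ≤ (trigArcsinPoly t 0 (n + 1)).eval x ∧
      (trigArcsinPoly t 0 (n + 1)).eval x ≤ 1 := by
  have ht2 : t ^ 2 ≤ 1 := (sq_le_one_iff_abs_le_one t).2 ht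
  have hx2 : x ^ 2 ≤ 1 := (sq_le_one_iff_abs_le_one x).2 hx
  induction n with
  | zero =>
    simp only [trigArcsinPoly_succ, trigArcsinPoly_zero, trigArcsinCoeff]
    norm_num
    refine ⟨?_, ?_, ?_⟩ <;> nlinarith [sq_nonneg t, sq_nonneg x]
  | succ n ih =>
    obtain ⟨h1, h2, h3⟩ := ih
    have h := trigArcsinCoeff_succ_mul t 0 (n + 1)
    have hp0 : 0 ≤ x ^ (2 * (n + 1) + 0 + 2) := Even.pow_nonneg ⟨n + 2, by ring⟩ x
    have hp1 : x ^ (2 * (n + 1) + 0 + 2) ≤ 1 := by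
      rw [show 2 * (n + 1) + 0 + 2 = 2 * (n + 2) by ring, pow_mul]
      exact pow_le_one₀ (sq_nonneg x) hx2
    rw [trigArcsinPoly_succ t 0 (n + 1)]
    simp only [eval_add, eval_mul, eval_C, eval_pow, eval_X]
    generalize trigArcsinCoeff t 0 (n + 1 + 1) = b at *
    generalize trigArcsinCoeff t 0 (n + 1) = a at *
    generalize x ^ (2 * (n + 1) + 0 + 2) = y at *
    push_cast at h ⊢
    have hn : (0 : ℝ) ≤ n := n.cast_nonneg
    generalize (n : ℝ) = m at *
    have hb : b ≤ 0 := by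
      by_contra! hb
      nlinarith [mul_pos hb (show 0 < (2 * (m + 1) + 0 + 1) * (2 * (m + 1) + 0 + 2) by positivity),
        mul_nonneg (neg_nonneg.2 h1) (show 0 ≤ (2 * (m + 1) + 0) ^ 2 - t ^ 2 by nlinarith)]
    have key : (2 * m + 5) * (-b) ≤ 2 * (m + 1) * (-a) := by
      have hD : 0 < (2 * (m + 1) + 0 + 1) * (2 * (m + 1) + 0 + 2) := by positivity
      refine le_of_mul_le_mul_right ?_ hD
      have : (2 * m + 5) * (-b) * ((2 * (m + 1) + 0 + 1) * (2 * (m + 1) + 0 + 2))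
          = (2 * m + 5) * ((2 * (m + 1) + 0) ^ 2 - t ^ 2) * (-a) := by
        linear_combination (-(2 * m + 5)) * h
      rw [this]
      have : (2 * m + 5) * ((2 * (m + 1) + 0) ^ 2 - t ^ 2)
          ≤ 2 * (m + 1) * ((2 * (m + 1) + 0 + 1) * (2 * (m + 1) + 0 + 2)) := by
        nlinarith [mul_nonneg hn (sq_nonneg t), sq_nonneg t, mul_nonneg hn hn]
      nlinarith [mul_le_mul_of_nonneg_right this (neg_nonneg.2 h1)]
    have hby : b ≤ b * y := by nlinarith
    have hby' : b * y ≤ 0 := mul_nonpos_of_nonpos_of_nonneg hb hp0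
    exact ⟨hb, by linarith, by linarith⟩

lemma abs_eval_trigArcsinPoly_even_le_one {t x : ℝ} (ht : |t| ≤ 1) (hx : |x| ≤ 1) (n : ℕ) :
    |(trigArcsinPoly t 0 n).eval x| ≤ 1 := by
  cases n with
  | zero => simp [trigArcsinPoly_zero]
  | succ n =>
    obtain ⟨h1, h2, h3⟩ := trigArcsinPoly_even_bounds ht hx n
    have ht2 : t ^ 2 ≤ 1 := (sq_le_one_iff_abs_le_one t).2 ht
    have h4 := mul_nonneg (show (0 : ℝ) ≤ 2 * (n + 1) by positivity) (neg_nonneg.2 h1)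
    exact abs_le.2 ⟨by linarith, h3⟩

lemma trigArcsinPoly_odd_bounds {t x : ℝ} (ht : |t| ≤ 1) (hx : |x| ≤ 1) (n : ℕ) :
    0 ≤ trigArcsinCoeff t 1 n ∧
      |(trigArcsinPoly t 1 n).eval x|
        + (2 * n + 3 * (1 - t ^ 2) / (5 + t ^ 2)) * trigArcsinCoeff t 1 n
        ≤ 1 + 3 * (1 - t ^ 2) / (5 + t ^ 2) := by
  have ht2 : t ^ 2 ≤ 1 := (sq_le_one_iff_abs_le_one t).2 ht
  have ht0 := sq_nonneg t
  obtain ⟨β, hβ⟩ : ∃ β, β = 3 * (1 - t ^ 2) / (5 + t ^ 2) := ⟨_, rfl⟩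
  have hβ' : β * (5 + t ^ 2) = 3 * (1 - t ^ 2) := by rw [hβ]; field_simp
  have hβ0 : 0 ≤ β := hβ ▸ div_nonneg (by linarith) (by linarith)
  rw [← hβ]
  induction n with
  | zero => simpa [trigArcsinPoly_zero, trigArcsinCoeff] using hx
  | succ n ih =>
    obtain ⟨h1, h2⟩ := ih
    have h := trigArcsinCoeff_succ_mul t 1 n
    have hp1 : |x ^ (2 * n + 1 + 2)| ≤ 1 := by
      rw [abs_pow]
      exact pow_le_one₀ (abs_nonneg x) hx
    rw [trigArcsinPoly_succ]
    simp only [eval_add, eval_mul, eval_C, eval_pow, eval_X]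
    generalize trigArcsinCoeff t 1 (n + 1) = b at *
    generalize trigArcsinCoeff t 1 n = a at *
    generalize x ^ (2 * n + 1 + 2) = y at *
    push_cast at h ⊢
    have hn : (0 : ℝ) ≤ n := n.cast_nonneg
    generalize (n : ℝ) = m at *
    have hD : 0 < (2 * m + 1 + 1) * (2 * m + 1 + 2) := by positivity
    have hk : 0 ≤ (2 * m + 1) ^ 2 - t ^ 2 := by nlinarith
    have hb : 0 ≤ b := by
      refine nonneg_of_mul_nonneg_left ?_ hD
      rw [h]
      exact mul_nonneg hk h1
    have key : (2 * m + 3 + β) * b ≤ (2 * m + β) * a := by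
      refine le_of_mul_le_mul_right ?_ hD
      have : (2 * m + 3 + β) * b * ((2 * m + 1 + 1) * (2 * m + 1 + 2))
          = (2 * m + 3 + β) * ((2 * m + 1) ^ 2 - t ^ 2) * a := by
        linear_combination (2 * m + 3 + β) * h
      rw [this]
      have : (2 * m + 3 + β) * ((2 * m + 1) ^ 2 - t ^ 2)
          ≤ (2 * m + β) * ((2 * m + 1 + 1) * (2 * m + 1 + 2)) := by
        have h5 : 1 - t ^ 2 ≤ 3 * β := by nlinarith
        nlinarith [mul_le_mul_of_nonneg_left h5 hn]
      nlinarith [mul_le_mul_of_nonneg_right this h1]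
    have hby : |b * y| ≤ b := by
      rw [abs_mul, abs_of_nonneg hb]
      exact mul_le_of_le_one_right hb hp1
    refine ⟨hb, ?_⟩
    have := abs_add_le ((trigArcsinPoly t 1 n).eval x) (b * y)
    linarith

lemma abs_mul_eval_trigArcsinPoly_odd_le_one {t x : ℝ} (ht : |t| ≤ 1) (hx : |x| ≤ 1) (n : ℕ) :
    |t * (trigArcsinPoly t 1 n).eval x| ≤ 1 := by
  obtain ⟨h1, h2⟩ := trigArcsinPoly_odd_bounds ht hx n
  have ht2 : t ^ 2 ≤ 1 := (sq_le_one_iff_abs_le_one t).2 ht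
  have hβ0 : 0 ≤ 3 * (1 - t ^ 2) / (5 + t ^ 2) := div_nonneg (by linarith) (by positivity)
  have h3 : 0 ≤ (2 * n + 3 * (1 - t ^ 2) / (5 + t ^ 2)) * trigArcsinCoeff t 1 n :=
    mul_nonneg (add_nonneg (by positivity) hβ0) h1
  rw [abs_mul]
  calc |t| * |(trigArcsinPoly t 1 n).eval x|
      ≤ |t| * (1 + 3 * (1 - t ^ 2) / (5 + t ^ 2)) := by gcongr; linarith
    _ = |t| * (8 - 2 * |t| ^ 2) / (5 + |t| ^ 2) := by rw [← sq_abs t]; field_simp; ring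
    _ ≤ 1 := by
      rw [div_le_one (by positivity)]
      nlinarith [mul_nonneg (sq_nonneg (|t| - 1)) (show 0 ≤ 2 * |t| + 5 by positivity)]

lemma two_mul_add_one_sq_le (n : ℕ) : (2 * n + 1 : ℝ) ^ 2 ≤ 9 * 2 ^ n := by
  have h : ∀ m : ℕ, (2 * (m + 2) + 1 : ℝ) ^ 2 ≤ 9 * 2 ^ (m + 2) := by
    intro m
    induction m with
    | zero => norm_num
    | succ m ih =>
      rw [pow_succ (2 : ℝ) (m + 1 + 1)]
      push_cast
      have : (0 : ℝ) ≤ m := m.cast_nonneg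
      nlinarith
  match n with
  | 0 => norm_num
  | 1 => norm_num
  | m + 2 => exact_mod_cast h m

lemma abs_trigArcsinPoly_residual_le {t x : ℝ} (ht : |t| ≤ 1) {e : ℕ} (he : e ≤ 1) (n : ℕ)
    (hx : x ∈ Set.Icc (-(1 / 2) : ℝ) (1 / 2)) :
    |(1 - x ^ 2) * (derivative (derivative (trigArcsinPoly t e n))).eval x
        - x * (derivative (trigArcsinPoly t e n)).eval x + t ^ 2 * (trigArcsinPoly t e n).eval x|
      ≤ 9 / 2 ^ n := by
  have ht2 : t ^ 2 ≤ 1 := (sq_le_one_iff_abs_le_one t).2 ht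
  have he' : (e : ℝ) ≤ 1 := by exact_mod_cast he
  have hk : (0 : ℝ) ≤ 2 * n + e := by positivity
  have hn : (0 : ℝ) ≤ n := n.cast_nonneg
  have hx' : |x| ≤ 1 / 2 := abs_le.2 hx
  rw [trigArcsinPoly_residual t he, abs_neg, abs_mul, abs_mul]
  have h1 : |(2 * n + e : ℝ) ^ 2 - t ^ 2| ≤ (2 * n + 1) ^ 2 := by
    rw [abs_le]
    constructor <;> nlinarith [sq_nonneg t, e.cast_nonneg (α := ℝ)]
  have h2 : |x ^ (2 * n + e)| ≤ 1 / (2 ^ n * 2 ^ n) := by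
    rw [abs_pow, pow_add, pow_mul']
    calc (|x| ^ n) ^ 2 * |x| ^ e ≤ (|x| ^ n) ^ 2 * 1 := by
          gcongr
          exact pow_le_one₀ (abs_nonneg x) (by linarith)
      _ ≤ ((1 / 2) ^ n) ^ 2 * 1 := by gcongr
      _ = 1 / (2 ^ n * 2 ^ n) := by rw [one_div_pow]; field_simp
  calc _ ≤ (2 * n + 1 : ℝ) ^ 2 * 1 * (1 / (2 ^ n * 2 ^ n)) := by
        gcongr
        exact abs_trigArcsinCoeff_le_one ht e n
    _ ≤ 9 * 2 ^ n * 1 * (1 / (2 ^ n * 2 ^ n)) := by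
        gcongr
        exact two_mul_add_one_sq_le n
    _ = 9 / 2 ^ n := by field_simp

lemma trigArcsinPoly_eval_zero (t : ℝ) (n : ℕ) :
    (trigArcsinPoly t 0 n).eval 0 = 1 ∧ (derivative (trigArcsinPoly t 0 n)).eval 0 = 0 ∧
      (trigArcsinPoly t 1 n).eval 0 = 0 ∧ (derivative (trigArcsinPoly t 1 n)).eval 0 = 1 := by
  induction n with
  | zero => simp [trigArcsinPoly_zero]
  | succ n ih => simp [trigArcsinPoly_succ, ih]

lemma abs_eval_trigArcsinPoly_sub_cos_le {t x : ℝ} (ht : |t| ≤ 1) (n : ℕ)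
    (hx : x ∈ Set.Icc (-(1 / 2) : ℝ) (1 / 2)) :
    |(trigArcsinPoly t 0 n).eval x - cos (t * arcsin x)| ≤ 18 / 2 ^ n := by
  obtain ⟨h0, h0', -, -⟩ := trigArcsinPoly_eval_zero t n
  have := abs_eval_sub_trig_arcsin_le (t := t) (β := 0) _ h0 (by rw [h0', mul_zero])
    (fun y hy => abs_trigArcsinPoly_residual_le ht zero_le_one n hy) hx
  rw [one_mul, zero_mul, add_zero] at this
  exact this.trans_eq (by ring)

lemma abs_mul_eval_trigArcsinPoly_sub_sin_le {t x : ℝ} (ht : |t| ≤ 1) (n : ℕ)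
    (hx : x ∈ Set.Icc (-(1 / 2) : ℝ) (1 / 2)) :
    |t * (trigArcsinPoly t 1 n).eval x - sin (t * arcsin x)| ≤ 18 / 2 ^ n := by
  obtain ⟨-, -, h0, h0'⟩ := trigArcsinPoly_eval_zero t n
  have := abs_eval_sub_trig_arcsin_le (C t * trigArcsinPoly t 1 n) (t := t) (α := 0) (β := 1)
    (M := 9 / 2 ^ n) (by simp [h0]) (by simp [h0'])
    (fun y hy => by
      have h := abs_trigArcsinPoly_residual_le ht le_rfl n hy
      refine le_trans (le_of_eq_of_le ?_ (mul_le_of_le_one_left (abs_nonneg _) ht)) h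
      rw [← abs_mul]
      congr 1
      simp
      ring) hx
  rw [one_mul, zero_mul, zero_add, eval_mul, eval_C] at this
  exact this.trans_eq (by ring)

lemma exists_nat_le_mul_log {ε : ℝ} (hε : 0 < ε) (hε' : ε ≤ 1 / 2) :
    ∃ n : ℕ, 18 / 2 ^ n ≤ ε ∧ (2 * n + 1 : ℝ) ≤ 25 * log (1 / ε) := by
  have hlog2 := log_two_gt_d9
  have hlog2' := log_two_lt_d9
  have hL : log 2 ≤ log (1 / ε) := by
    refine log_le_log two_pos ?_
    rw [le_div_iff₀ hε]
    linarith
  obtain ⟨m, hm⟩ : ∃ m : ℕ, m = ⌈log (1 / ε) / log 2⌉₊ := ⟨_, rfl⟩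
  have hm1 : log (1 / ε) / log 2 ≤ m := hm ▸ Nat.le_ceil _
  have hm2 : (m : ℝ) < log (1 / ε) / log 2 + 1 :=
    hm ▸ Nat.ceil_lt_add_one (div_nonneg (by linarith) (by linarith))
  refine ⟨m + 5, ?_, ?_⟩
  · have h : 1 / ε ≤ 2 ^ m := by
      rw [div_le_iff₀ (by linarith), ← log_pow] at hm1
      exact (log_le_log_iff (by positivity) (by positivity)).1 hm1
    rw [div_le_iff₀ hε] at h
    rw [div_le_iff₀ (by positivity), pow_add]
    nlinarith
  · have h : log (1 / ε) / log 2 ≤ 3 / 2 * log (1 / ε) := by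
      rw [div_le_iff₀ (by linarith)]
      nlinarith
    push_cast
    linarith

/-- **Bounded polynomial approximations of cos(t·arcsin) and sin(t·arcsin)**
(Corollary 3.15): there are an even polynomial `p` and an odd polynomial `q`
of degree `O(log(1/ε))`, bounded by `1` on `[-1, 1]`, which are `ε`-close to
`cos(t arcsin x)` and `sin(t arcsin x)` respectively on `[-1/2, 1/2]`. -/
theorem cos_sin_arcsin_bounded_approx :
    ∃ C : ℝ, 1 ≤ C ∧
      ∀ ε t : ℝ, 0 < ε → ε < 1 → t ∈ Set.Icc (-1 : ℝ) 1 →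
        ∃ p q : Polynomial ℝ,
          (∀ x : ℝ, p.eval (-x) = p.eval x) ∧
          (∀ x : ℝ, q.eval (-x) = -q.eval x) ∧
          (p.natDegree : ℝ) ≤ C * Real.log (1 / ε) ∧
          (q.natDegree : ℝ) ≤ C * Real.log (1 / ε) ∧
          (∀ x : ℝ, x ∈ Set.Icc (-1 : ℝ) 1 → |p.eval x| ≤ 1) ∧
          (∀ x : ℝ, x ∈ Set.Icc (-1 : ℝ) 1 → |q.eval x| ≤ 1) ∧
          (∀ x : ℝ, x ∈ Set.Icc (-(1 / 2) : ℝ) (1 / 2) →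
            |p.eval x - Real.cos (t * Real.arcsin x)| ≤ ε) ∧
          (∀ x : ℝ, x ∈ Set.Icc (-(1 / 2) : ℝ) (1 / 2) →
            |q.eval x - Real.sin (t * Real.arcsin x)| ≤ ε) := by
  refine ⟨25, by norm_num, fun ε t hε hε1 ht => ?_⟩
  have ht' : |t| ≤ 1 := abs_le.2 ht
  obtain hε2 | hε2 := le_or_gt ε (1 / 2)
  · obtain ⟨n, hn, hdeg⟩ := exists_nat_le_mul_log hε hε2
    refine ⟨trigArcsinPoly t 0 n, C t * trigArcsinPoly t 1 n, fun x => ?_, fun x => ?_,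
      ?_, ?_, fun x hx => abs_eval_trigArcsinPoly_even_le_one ht' (abs_le.2 hx) n,
      fun x hx => ?_, fun x hx => (abs_eval_trigArcsinPoly_sub_cos_le ht' n hx).trans hn,
      fun x hx => ?_⟩
    · rw [eval_neg_trigArcsinPoly, pow_zero, one_mul]
    · rw [eval_mul, eval_mul, eval_neg_trigArcsinPoly, eval_C, eval_C]
      ring
    · refine le_trans ?_ hdeg
      exact_mod_cast (natDegree_trigArcsinPoly_le t 0 n).trans (Nat.le_succ _)
    · refine le_trans ?_ hdeg
      exact_mod_cast (natDegree_C_mul_le _ _).trans (natDegree_trigArcsinPoly_le t 1 n)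
    · rw [eval_mul, eval_C]
      exact abs_mul_eval_trigArcsinPoly_odd_le_one ht' (abs_le.2 hx) n
    · rw [eval_mul, eval_C]
      exact (abs_mul_eval_trigArcsinPoly_sub_sin_le ht' n hx).trans hn
  · have hlog : 0 ≤ 25 * log (1 / ε) := by
      refine mul_nonneg (by norm_num) (log_nonneg ?_)
      rw [le_div_iff₀ hε]
      linarith
    have hθ : ∀ x ∈ Set.Icc (-(1 / 2) : ℝ) (1 / 2),
        |sin (t * arcsin x)| ≤ 1 / 2 ∧ 1 / 2 ≤ cos (t * arcsin x) := by
      intro x hx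
      have h6 : |t * arcsin x| ≤ π / 6 := by
        rw [abs_mul]
        exact (mul_le_of_le_one_left (abs_nonneg _) ht').trans (abs_arcsin_le_pi_div_six hx)
      have h := sin_mem_Icc_of_abs_le_pi_div_six h6
      have h7 := abs_le.1 h6
      have hc : 0 ≤ cos (t * arcsin x) :=
        cos_nonneg_of_mem_Icc ⟨by linarith [pi_pos], by linarith [pi_pos]⟩
      refine ⟨abs_le.2 h, ?_⟩
      nlinarith [sin_sq_add_cos_sq (t * arcsin x), h.1, h.2]
    refine ⟨1, 0, by simp, by simp, by simpa using hlog, by simpa using hlog, by simp, by simp,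
      fun x hx => ?_, fun x hx => ?_⟩
    · have := (hθ x hx).2
      rw [eval_one, abs_of_nonneg (by linarith [cos_le_one (t * arcsin x)])]
      linarith
    · rw [eval_zero, zero_sub, abs_neg]
      exact (hθ x hx).1.trans hε2.le
end
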